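/- Let C ⊆ NC°• be a category of noncrossing two-colored partitions in case H. (i) If C is globally colorized, then C = ⟨b_k, ∘•∘•, ∘∘⊗••⟩ for k = k(C) ∈ 2ℕ₀. (ii) If C is locally colorized and K^C(•,•) = ∅, then C = ⟨∘•∘•⟩; if C is locally colorized and K^C(•,•) ≠ ∅, then C = ⟨b_k, b_d⊗b̃_d, ∘∘••, ∘•∘•⟩ for k = k(C) ∈ ℕ₀∖{1,2} and d = d(C) ∈ ℕ₀∖{1,2}, with the convention b₀ = ∅. -/

import Mathlib

noncomputable section
namespace CTCP

/-- Colors of points: `true` = white (∘), `false` = black (•). -/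
abbrev Color := Bool

def white : Color := true
def black : Color := false

/-- A two-colored partition with `k` upper and `l` lower points.  The block
structure is recorded as a setoid on the disjoint union of the points. -/
structure TCP where
  k : ℕ
  l : ℕ
  upColor : Fin k → Color
  lowColor : Fin l → Color
  rel : Setoid (Fin k ⊕ Fin l)

/-- The disjoint union of two equivalence relations. -/
def sumRel {α β : Type*} (r : Setoid α) (s : Setoid β) : (α ⊕ β) → (α ⊕ β) → Prop
  | .inl a, .inl b => r.r a b
  | .inr a, .inr b => s.r a b
  | _, _ => False

def sumSetoid {α β : Type*} (r : Setoid α) (s : Setoid β) : Setoid (α ⊕ β) where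
  r := sumRel r s
  iseqv := by
    constructor
    · rintro (a | a)
      · exact r.iseqv.refl a
      · exact s.iseqv.refl a
    · rintro (a | a) (b | b) h
      · exact r.iseqv.symm h
      · exact h.elim
      · exact h.elim
      · exact s.iseqv.symm h
    · rintro (a | a) (b | b) (c | c) h₁ h₂
      all_goals first
        | exact r.iseqv.trans h₁ h₂
        | exact s.iseqv.trans h₁ h₂
        | exact h₁.elim
        | exact h₂.elim

def splitPt (p q : TCP) :
    (Fin (p.k + q.k) ⊕ Fin (p.l + q.l)) → ((Fin p.k ⊕ Fin p.l) ⊕ (Fin q.k ⊕ Fin q.l))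
  | .inl i => (finSumFinEquiv.symm i).elim (fun a => .inl (.inl a)) (fun b => .inr (.inl b))
  | .inr j => (finSumFinEquiv.symm j).elim (fun a => .inl (.inr a)) (fun b => .inr (.inr b))

/-- Tensor product (horizontal concatenation) of two-colored partitions. -/
def tensor (p q : TCP) : TCP where
  k := p.k + q.k
  l := p.l + q.l
  upColor := fun i => (finSumFinEquiv.symm i).elim p.upColor q.upColor
  lowColor := fun j => (finSumFinEquiv.symm j).elim p.lowColor q.lowColor
  rel := Setoid.comap (splitPt p q) (sumSetoid p.rel q.rel)

def compEmbMid (q p : TCP) (h : q.l = p.k) :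
    (Fin p.k ⊕ Fin p.l) → ((Fin q.k ⊕ Fin q.l) ⊕ Fin p.l)
  | .inl i => .inl (.inr (Fin.cast h.symm i))
  | .inr j => .inr j

/-- The relation generating the blocks of the composition of `q` and `p`:
the blocks of `q` together with the blocks of `p`, glued along the middle row. -/
def compRel (q p : TCP) (h : q.l = p.k) :
    ((Fin q.k ⊕ Fin q.l) ⊕ Fin p.l) → ((Fin q.k ⊕ Fin q.l) ⊕ Fin p.l) → Prop :=
  fun t t' =>
    (∃ x y, q.rel.r x y ∧ t = .inl x ∧ t' = .inl y) ∨
    (∃ x y, p.rel.r x y ∧ t = compEmbMid q p h x ∧ t' = compEmbMid q p h y)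

/-- Composition (vertical concatenation) of `q ∈ P(k,l)` with `p ∈ P(l,m)`:
blocks are joined through the middle points, which are then deleted. -/
def comp (q p : TCP) (h : q.l = p.k) : TCP where
  k := q.k
  l := p.l
  upColor := q.upColor
  lowColor := p.lowColor
  rel := Setoid.comap
    (Sum.elim (fun i : Fin q.k => (Sum.inl (Sum.inl i) : (Fin q.k ⊕ Fin q.l) ⊕ Fin p.l))
      (fun j : Fin p.l => Sum.inr j))
    (Relation.EqvGen.setoid (compRel q p h))

/-- The colors of the lower row of `q` match the colors of the upper row of `p`. -/
def ColorsMatch (q p : TCP) (h : q.l = p.k) : Prop :=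
  ∀ j : Fin q.l, q.lowColor j = p.upColor (Fin.cast h j)

/-- Involution: reflection at the horizontal axis. -/
def invol (p : TCP) : TCP where
  k := p.l
  l := p.k
  upColor := p.lowColor
  lowColor := p.upColor
  rel := Setoid.comap Sum.swap p.rel

/-- Vertical reflection: reflection at the vertical axis. -/
def vref (p : TCP) : TCP where
  k := p.k
  l := p.l
  upColor := fun i => p.upColor i.rev
  lowColor := fun j => p.lowColor j.rev
  rel := Setoid.comap (Sum.map Fin.rev Fin.rev) p.rel

/-- Inversion of colors. -/
def cinv (p : TCP) : TCP where
  k := p.k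
  l := p.l
  upColor := fun i => !(p.upColor i)
  lowColor := fun j => !(p.lowColor j)
  rel := p.rel

/-- Verticolor reflection `p̃`: vertical reflection combined with color inversion. -/
def vcref (p : TCP) : TCP := cinv (vref p)

/-- Rotation of the leftmost upper point to the left end of the lower row
(inverting its color). -/
def rotULdown (p : TCP) (h : 0 < p.k) : TCP where
  k := p.k - 1
  l := p.l + 1
  upColor := fun i => p.upColor ⟨i.1 + 1, by have := i.2; omega⟩
  lowColor := fun j =>
    if hj : j.1 = 0 then !(p.upColor ⟨0, h⟩)
    else p.lowColor ⟨j.1 - 1, by have := j.2; omega⟩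
  rel := Setoid.comap
    (Sum.elim
      (fun i : Fin (p.k - 1) => (Sum.inl ⟨i.1 + 1, by have := i.2; omega⟩ : Fin p.k ⊕ Fin p.l))
      (fun j : Fin (p.l + 1) =>
        if hj : j.1 = 0 then Sum.inl ⟨0, h⟩
        else Sum.inr ⟨j.1 - 1, by have := j.2; omega⟩))
    p.rel

/-- Rotation of the rightmost upper point to the right end of the lower row
(inverting its color). -/
def rotURdown (p : TCP) (h : 0 < p.k) : TCP where
  k := p.k - 1
  l := p.l + 1
  upColor := fun i => p.upColor ⟨i.1, by have := i.2; omega⟩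
  lowColor := fun j =>
    if hj : j.1 < p.l then p.lowColor ⟨j.1, hj⟩
    else !(p.upColor ⟨p.k - 1, by omega⟩)
  rel := Setoid.comap
    (Sum.elim
      (fun i : Fin (p.k - 1) => (Sum.inl ⟨i.1, by have := i.2; omega⟩ : Fin p.k ⊕ Fin p.l))
      (fun j : Fin (p.l + 1) =>
        if hj : j.1 < p.l then Sum.inr ⟨j.1, hj⟩
        else Sum.inl ⟨p.k - 1, by omega⟩))
    p.rel

/-- Rotation of the leftmost lower point to the left end of the upper row
(inverting its color). -/
def rotULup (p : TCP) (h : 0 < p.l) : TCP where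
  k := p.k + 1
  l := p.l - 1
  upColor := fun i =>
    if hi : i.1 = 0 then !(p.lowColor ⟨0, h⟩)
    else p.upColor ⟨i.1 - 1, by have := i.2; omega⟩
  lowColor := fun j => p.lowColor ⟨j.1 + 1, by have := j.2; omega⟩
  rel := Setoid.comap
    (Sum.elim
      (fun i : Fin (p.k + 1) =>
        if hi : i.1 = 0 then (Sum.inr ⟨0, h⟩ : Fin p.k ⊕ Fin p.l)
        else Sum.inl ⟨i.1 - 1, by have := i.2; omega⟩)
      (fun j : Fin (p.l - 1) => Sum.inr ⟨j.1 + 1, by have := j.2; omega⟩))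
    p.rel

/-- Rotation of the rightmost lower point to the right end of the upper row
(inverting its color). -/
def rotURup (p : TCP) (h : 0 < p.l) : TCP where
  k := p.k + 1
  l := p.l - 1
  upColor := fun i =>
    if hi : i.1 < p.k then p.upColor ⟨i.1, hi⟩
    else !(p.lowColor ⟨p.l - 1, by omega⟩)
  lowColor := fun j => p.lowColor ⟨j.1, by have := j.2; omega⟩
  rel := Setoid.comap
    (Sum.elim
      (fun i : Fin (p.k + 1) =>
        if hi : i.1 < p.k then (Sum.inl ⟨i.1, hi⟩ : Fin p.k ⊕ Fin p.l)
        else Sum.inr ⟨p.l - 1, by omega⟩)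
      (fun j : Fin (p.l - 1) => Sum.inr ⟨j.1, by have := j.2; omega⟩))
    p.rel

/-- `p'` is obtained from `p` by rotating an outermost point of one row to the
corresponding end of the other row, inverting its color. -/
def IsRotationOf (p' p : TCP) : Prop :=
  (∃ h : 0 < p.k, p' = rotULdown p h) ∨ (∃ h : 0 < p.k, p' = rotURdown p h) ∨
  (∃ h : 0 < p.l, p' = rotULup p h) ∨ (∃ h : 0 < p.l, p' = rotURup p h)

/-- A partition with no upper points, given by colors and block labels. -/
def mkLower (n : ℕ) (color : Fin n → Color) (lbl : Fin n → ℕ) : TCP where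
  k := 0
  l := n
  upColor := Fin.elim0
  lowColor := color
  rel := Setoid.ker (Sum.elim Fin.elim0 lbl)

/-- The identity partition of color `c`. -/
def idPart (c : Color) : TCP where
  k := 1
  l := 1
  upColor := fun _ => c
  lowColor := fun _ => c
  rel := ⊤

/-- The pair partition on two lower points of colors `c₁`, `c₂`. -/
def pairLower (c₁ c₂ : Color) : TCP := mkLower 2 ![c₁, c₂] (fun _ => 0)

/-- The singleton of color `c`. -/
def singl (c : Color) : TCP := mkLower 1 (fun _ => c) (fun _ => 0)

/-- `bPart s` : one block on `s` white lower points (`bPart 0` is the empty partition). -/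
def bPart (s : ℕ) : TCP := mkLower s (fun _ => white) (fun _ => 0)

/-- One block on four lower points with the given colors. -/
def fourBlock (c₁ c₂ c₃ c₄ : Color) : TCP := mkLower 4 ![c₁, c₂, c₃, c₄] (fun _ => 0)

/-- The four-block ∘•∘•. -/
def fourWBWB : TCP := fourBlock white black white black

/-- The four-block ∘∘••. -/
def fourWWBB : TCP := fourBlock white white black black

/-- The empty partition. -/
def emptyPart : TCP := mkLower 0 Fin.elim0 Fin.elim0

/-- The partition ∘⊗• (a white and a black singleton). -/
def singPair : TCP := tensor (singl white) (singl black)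

/-- The partition ∘∘⊗••. -/
def wwbb : TCP := tensor (pairLower white white) (pairLower black black)

/-- The crossing partition `X` on four white points: first upper point connected to the
second lower point, second upper point connected to the first lower point. -/
def crossPart : TCP where
  k := 2
  l := 2
  upColor := fun _ => white
  lowColor := fun _ => white
  rel := Setoid.ker (Sum.elim (fun i : Fin 2 => (i.1 : ℕ)) (fun j : Fin 2 => 1 - j.1))

/-- `n`-fold tensor power. -/
def tensorPow (p : TCP) : ℕ → TCP
  | 0 => emptyPart
  | n + 1 => tensor (tensorPow p n) p

/-- The partition `p_d`: from left to right, `d` white singletons, a white point, `d` black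
singletons and a black point, the two non-singleton points forming a pair block. -/
def pPart (d : ℕ) : TCP :=
  mkLower (2 * d + 2) (fun j => decide (j.1 ≤ d))
    (fun j => if j.1 = d ∨ j.1 = 2 * d + 1 then 0 else j.1 + 1)

/-- The partition `p′_r`: from left to right, `r+1` white singletons, a black point, `r−1`
black singletons and a black point, the black non-singleton points forming a pair block;
for `r = 0` the middle consists of one white singleton instead. -/
def pPrime (r : ℕ) : TCP :=
  if r = 0 then
    mkLower 4 ![white, black, white, black]
      (fun j => if j.1 = 1 ∨ j.1 = 3 then 0 else j.1 + 1)
  else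
    mkLower (2 * r + 2) (fun j => decide (j.1 ≤ r))
      (fun j => if j.1 = r + 1 ∨ j.1 = 2 * r + 1 then 0 else j.1 + 1)

/-- A category of two-colored partitions: a class of two-colored partitions closed under
tensor products, composition (when defined) and involution, containing both bicolored
pair partitions and both identity partitions. -/
structure IsCategory (C : Set TCP) : Prop where
  tensor_mem : ∀ p ∈ C, ∀ q ∈ C, tensor p q ∈ C
  comp_mem : ∀ q ∈ C, ∀ p ∈ C, ∀ h : q.l = p.k, ColorsMatch q p h → comp q p h ∈ C
  invol_mem : ∀ p ∈ C, invol p ∈ C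
  idw_mem : idPart white ∈ C
  idb_mem : idPart black ∈ C
  pairwb_mem : pairLower white black ∈ C
  pairbw_mem : pairLower black white ∈ C

/-- The smallest category of partitions containing `S`. -/
def generated (S : Set TCP) : Set TCP :=
  {p | ∀ C : Set TCP, IsCategory C → S ⊆ C → p ∈ C}

/-- `c(p)` : (white lower points + black upper points) − (black lower points + white upper
points). -/
def cval (p : TCP) : ℤ :=
  ((Nat.card {j : Fin p.l // p.lowColor j = white} +
      Nat.card {i : Fin p.k // p.upColor i = black} : ℕ) : ℤ) -
    ((Nat.card {j : Fin p.l // p.lowColor j = black} +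
      Nat.card {i : Fin p.k // p.upColor i = white} : ℕ) : ℤ)

/-- Position of a point on the line obtained by rotating all upper points down to the
left of the lower row. -/
def linePos (p : TCP) : (Fin p.k ⊕ Fin p.l) → ℕ :=
  Sum.elim (fun i => p.k - 1 - i.1) (fun j => p.k + j.1)

/-- A partition is noncrossing if its strings can be drawn without crossings. -/
def Noncrossing (p : TCP) : Prop :=
  ∀ a b x y : Fin p.k ⊕ Fin p.l,
    linePos p a < linePos p b → linePos p b < linePos p x → linePos p x < linePos p y →
    p.rel.r a x → p.rel.r b y → p.rel.r a b

/-- The number of points in the block of the point `x`. -/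
def blockSize (p : TCP) (x : Fin p.k ⊕ Fin p.l) : ℕ := Nat.card {y // p.rel.r x y}

/-- The partition obtained from `p` by rotating all upper points down, so that it has no
upper points. -/
def toLine (p : TCP) : TCP where
  k := 0
  l := p.k + p.l
  upColor := Fin.elim0
  lowColor := fun j =>
    if hj : j.1 < p.k then !(p.upColor ⟨p.k - 1 - j.1, by omega⟩)
    else p.lowColor ⟨j.1 - p.k, by have := j.2; omega⟩
  rel := Setoid.comap
    (Sum.elim (fun i : Fin 0 => (Fin.elim0 i : Fin p.k ⊕ Fin p.l))
      (fun j : Fin (p.k + p.l) =>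
        if hj : j.1 < p.k then Sum.inl ⟨p.k - 1 - j.1, by omega⟩
        else Sum.inr ⟨j.1 - p.k, by have := j.2; omega⟩))
    p.rel

def eraseLowRel (p : TCP) (j : ℕ) (hj : j + 1 < p.l) :
    (Fin p.k ⊕ Fin p.l) → (Fin p.k ⊕ Fin p.l) → Prop :=
  fun x y => p.rel.r x y ∨ (x = Sum.inr ⟨j, by omega⟩ ∧ y = Sum.inr ⟨j + 1, hj⟩)

/-- Erasing the `j`-th and `(j+1)`-th lower points of `p`, first joining their blocks. -/
def eraseLowerPair (p : TCP) (j : ℕ) (hj : j + 1 < p.l) : TCP where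
  k := p.k
  l := p.l - 2
  upColor := p.upColor
  lowColor := fun m =>
    if hm : m.1 < j then p.lowColor ⟨m.1, by omega⟩
    else p.lowColor ⟨m.1 + 2, by have := m.2; omega⟩
  rel := Setoid.comap
    (Sum.elim (fun i : Fin p.k => (Sum.inl i : Fin p.k ⊕ Fin p.l))
      (fun m : Fin (p.l - 2) =>
        if hm : m.1 < j then Sum.inr ⟨m.1, by omega⟩
        else Sum.inr ⟨m.1 + 2, by have := m.2; omega⟩))
    (Relation.EqvGen.setoid (eraseLowRel p j hj))

def eraseUpRel (p : TCP) (j : ℕ) (hj : j + 1 < p.k) :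
    (Fin p.k ⊕ Fin p.l) → (Fin p.k ⊕ Fin p.l) → Prop :=
  fun x y => p.rel.r x y ∨ (x = Sum.inl ⟨j, by omega⟩ ∧ y = Sum.inl ⟨j + 1, hj⟩)

/-- Erasing the `j`-th and `(j+1)`-th upper points of `p`, first joining their blocks. -/
def eraseUpperPair (p : TCP) (j : ℕ) (hj : j + 1 < p.k) : TCP where
  k := p.k - 2
  l := p.l
  upColor := fun m =>
    if hm : m.1 < j then p.upColor ⟨m.1, by omega⟩
    else p.upColor ⟨m.1 + 2, by have := m.2; omega⟩
  lowColor := p.lowColor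
  rel := Setoid.comap
    (Sum.elim
      (fun m : Fin (p.k - 2) =>
        if hm : m.1 < j then (Sum.inl ⟨m.1, by omega⟩ : Fin p.k ⊕ Fin p.l)
        else Sum.inl ⟨m.1 + 2, by have := m.2; omega⟩)
      (fun i : Fin p.l => Sum.inr i))
    (Relation.EqvGen.setoid (eraseUpRel p j hj))

/-- `p₁ ⊗ p₂ ∈ C` is in nest decomposed form, with the first point of `p₂` colored `x`
and the last point of `p₂` colored `y` (and those two points in the same block). -/
def InNDF (C : Set TCP) (x y : Color) (p₁ p₂ : TCP) : Prop :=
  tensor p₁ p₂ ∈ C ∧ Noncrossing (tensor p₁ p₂) ∧ p₁.k = 0 ∧ p₂.k = 0 ∧ 0 < p₁.l ∧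
    ∃ h : 2 ≤ p₂.l,
      p₂.lowColor ⟨0, by omega⟩ = x ∧ p₂.lowColor ⟨p₂.l - 1, by omega⟩ = y ∧
      p₂.rel.r (Sum.inr ⟨0, by omega⟩) (Sum.inr ⟨p₂.l - 1, by omega⟩)

/-- `K^C(x,y)`: the set of values `c(p₁)` over nest decomposed forms `p₁ ⊗ p₂ ∈ C` whose
outer block starts with color `x` and ends with color `y`. -/
def Kset (C : Set TCP) (x y : Color) : Set ℤ :=
  {n | ∃ p₁ p₂, InNDF C x y p₁ p₂ ∧ cval p₁ = n}

/-- The degree of reflection `k(C)`. -/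
def kdeg (C : Set TCP) : ℕ := sInf {n : ℕ | 0 < n ∧ ∃ p ∈ C, cval p = (n : ℤ)}

/-- The local parameter `d(C)`. -/
def ddeg (C : Set TCP) : ℕ := sInf {n : ℕ | 0 < n ∧ (n : ℤ) ∈ Kset C white black}

/-- The local parameter `r(C) = min {t ≥ 1 | t ∈ K^C(•,•)} − 1`. -/
def rdeg (C : Set TCP) : ℕ := sInf {t : ℕ | 1 ≤ t ∧ (t : ℤ) ∈ Kset C black black} - 1

/-- `C` is globally colorized if it contains `∘∘ ⊗ ••`. -/
def GloballyColorized (C : Set TCP) : Prop := wwbb ∈ C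

def CaseO (C : Set TCP) : Prop := singPair ∉ C ∧ fourWBWB ∉ C
def CaseB (C : Set TCP) : Prop := singPair ∈ C ∧ fourWBWB ∉ C
def CaseH (C : Set TCP) : Prop := singPair ∉ C ∧ fourWBWB ∈ C
def CaseS (C : Set TCP) : Prop := singPair ∈ C ∧ fourWBWB ∈ C

/-! Non-colored partitions. -/

/-- A non-colored partition with `k` upper and `l` lower points. -/
structure NCP where
  k : ℕ
  l : ℕ
  rel : Setoid (Fin k ⊕ Fin l)

namespace NCP

def splitPt (p q : NCP) :
    (Fin (p.k + q.k) ⊕ Fin (p.l + q.l)) → ((Fin p.k ⊕ Fin p.l) ⊕ (Fin q.k ⊕ Fin q.l))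
  | .inl i => (finSumFinEquiv.symm i).elim (fun a => .inl (.inl a)) (fun b => .inr (.inl b))
  | .inr j => (finSumFinEquiv.symm j).elim (fun a => .inl (.inr a)) (fun b => .inr (.inr b))

def tensor (p q : NCP) : NCP where
  k := p.k + q.k
  l := p.l + q.l
  rel := Setoid.comap (splitPt p q) (sumSetoid p.rel q.rel)

def compEmbMid (q p : NCP) (h : q.l = p.k) :
    (Fin p.k ⊕ Fin p.l) → ((Fin q.k ⊕ Fin q.l) ⊕ Fin p.l)
  | .inl i => .inl (.inr (Fin.cast h.symm i))
  | .inr j => .inr j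

def compRel (q p : NCP) (h : q.l = p.k) :
    ((Fin q.k ⊕ Fin q.l) ⊕ Fin p.l) → ((Fin q.k ⊕ Fin q.l) ⊕ Fin p.l) → Prop :=
  fun t t' =>
    (∃ x y, q.rel.r x y ∧ t = .inl x ∧ t' = .inl y) ∨
    (∃ x y, p.rel.r x y ∧ t = compEmbMid q p h x ∧ t' = compEmbMid q p h y)

def comp (q p : NCP) (h : q.l = p.k) : NCP where
  k := q.k
  l := p.l
  rel := Setoid.comap
    (Sum.elim (fun i : Fin q.k => (Sum.inl (Sum.inl i) : (Fin q.k ⊕ Fin q.l) ⊕ Fin p.l))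
      (fun j : Fin p.l => Sum.inr j))
    (Relation.EqvGen.setoid (compRel q p h))

def invol (p : NCP) : NCP where
  k := p.l
  l := p.k
  rel := Setoid.comap Sum.swap p.rel

/-- The non-colored identity partition. -/
def idN : NCP := ⟨1, 1, ⊤⟩

/-- The non-colored pair partition on two lower points. -/
def pairN : NCP := ⟨0, 2, ⊤⟩

end NCP

/-- A category of non-colored partitions. -/
structure IsCategoryN (D : Set NCP) : Prop where
  tensor_mem : ∀ p ∈ D, ∀ q ∈ D, NCP.tensor p q ∈ D
  comp_mem : ∀ q ∈ D, ∀ p ∈ D, ∀ h : q.l = p.k, NCP.comp q p h ∈ D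
  invol_mem : ∀ p ∈ D, NCP.invol p ∈ D
  id_mem : NCP.idN ∈ D
  pair_mem : NCP.pairN ∈ D

/-- The map `Ψ` forgetting the colors of a two-colored partition. -/
def forget (p : TCP) : NCP := ⟨p.k, p.l, p.rel⟩

/-- A word of colored points, each carrying the label of its block. -/
abbrev Word (α : Type) := List (Bool × α)

section Words
variable {α β γ : Type}

/-- Renaming the labels of a word. -/
def relabel (f : α → β) (w : Word α) : Word β := w.map fun x => (x.1, f x.2)

/-- The verticolor reflection of a word. -/
def bar (w : Word α) : Word α := (w.map fun x => (!x.1, x.2)).reverse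

/-- The two-colored partition with upper row `u` and lower row `v`, whose blocks are the
sets of points with equal labels. -/
def ofWords (u v : Word α) : TCP where
  k := u.length
  l := v.length
  upColor := fun i => u[i].1
  lowColor := fun j => v[j].1
  rel := Setoid.ker (Sum.elim (fun i => u[i].2) (fun j => v[j].2))

@[simp] theorem relabel_nil (f : α → β) : relabel f [] = [] := rfl

@[simp] theorem relabel_cons (f : α → β) (x : Bool × α) (w : Word α) :
    relabel f (x :: w) = (x.1, f x.2) :: relabel f w := rfl

@[simp] theorem relabel_append (f : α → β) (u v : Word α) :
    relabel f (u ++ v) = relabel f u ++ relabel f v := by simp [relabel]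

@[simp] theorem length_relabel (f : α → β) (w : Word α) : (relabel f w).length = w.length := by
  simp [relabel]

@[simp] theorem relabel_relabel (g : β → γ) (f : α → β) (w : Word α) :
    relabel g (relabel f w) = relabel (g ∘ f) w := by simp [relabel]

@[simp] theorem relabel_id (w : Word α) : relabel id w = w := by simp [relabel]

theorem relabel_congr {f g : α → β} {w : Word α} (h : ∀ x ∈ w, f x.2 = g x.2) :
    relabel f w = relabel g w := by
  apply List.map_congr_left
  intro x hx
  rw [h x hx]

@[simp] theorem bar_nil : bar ([] : Word α) = [] := rfl

@[simp] theorem bar_cons (x : Bool × α) (w : Word α) :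
    bar (x :: w) = bar w ++ [(!x.1, x.2)] := by simp [bar]

@[simp] theorem bar_append (u v : Word α) : bar (u ++ v) = bar v ++ bar u := by simp [bar]

@[simp] theorem bar_bar (w : Word α) : bar (bar w) = w := by
  induction w with
  | nil => rfl
  | cons x w ih => simp [ih]

@[simp] theorem length_bar (w : Word α) : (bar w).length = w.length := by simp [bar]

@[simp] theorem relabel_bar (f : α → β) (w : Word α) : relabel f (bar w) = bar (relabel f w) := by
  induction w with
  | nil => rfl
  | cons x w ih => simp [ih]

theorem TCP_ext {p q : TCP} (hk : p.k = q.k) (hl : p.l = q.l)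
    (hu : ∀ i, p.upColor i = q.upColor (Fin.cast hk i))
    (hlo : ∀ j, p.lowColor j = q.lowColor (Fin.cast hl j))
    (hr : ∀ x y, p.rel.r x y ↔
      q.rel.r (Sum.map (Fin.cast hk) (Fin.cast hl) x) (Sum.map (Fin.cast hk) (Fin.cast hl) y)) :
    p = q := by
  obtain ⟨k, l, uc, lc, r⟩ := p
  obtain ⟨k', l', uc', lc', r'⟩ := q
  dsimp only at hk hl
  subst hk hl
  have h1 : uc = uc' := funext hu
  have h2 : lc = lc' := funext hlo
  have h3 : r = r' := by
    ext x y
    have := hr x y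
    rcases x with x | x <;> rcases y with y | y <;> exact this
  subst h1 h2 h3
  rfl

/-- The label of a point of `ofWords u v`. -/
def ptLabel (u v : Word α) : Fin u.length ⊕ Fin v.length → α :=
  Sum.elim (fun i => u[i].2) (fun j => v[j].2)

theorem ofWords_rel {u v : Word α} {x y} :
    (ofWords u v).rel.r x y ↔ ptLabel u v x = ptLabel u v y := Iff.rfl

theorem eq_ofWords {k l : ℕ} {uc : Fin k → Color} {lc : Fin l → Color}
    {r : Setoid (Fin k ⊕ Fin l)} {u v : Word α} (hk : k = u.length) (hl : l = v.length)
    (lab : Fin k ⊕ Fin l → α)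
    (hu : ∀ i : Fin k, (uc i, lab (.inl i)) = u[i])
    (hv : ∀ j : Fin l, (lc j, lab (.inr j)) = v[j])
    (hr : ∀ x y, r.r x y ↔ lab x = lab y) :
    TCP.mk k l uc lc r = ofWords u v := by
  subst hk hl
  have hu' : ∀ i, lab (.inl i) = u[i].2 := fun i => by rw [← hu i]
  have hv' : ∀ i, lab (.inr i) = v[i].2 := fun i => by rw [← hv i]
  refine TCP_ext rfl rfl (fun i => ?_) (fun i => ?_) fun x y => ?_
  · exact congrArg Prod.fst (hu i)
  · exact congrArg Prod.fst (hv i)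
  · refine (hr x y).trans ?_
    rcases x with x | x <;> rcases y with y | y <;> simp only [hu', hv'] <;> rfl

theorem ofWords_relabel {f : α → β} {u v : Word α}
    (hf : ∀ x ∈ u ++ v, ∀ y ∈ u ++ v, f x.2 = f y.2 → x.2 = y.2) :
    ofWords u v = ofWords (relabel f u) (relabel f v) := by
  refine eq_ofWords (k := u.length) (l := v.length) (by simp) (by simp)
    (fun x => f (ptLabel u v x)) (fun i => by simp [relabel, ptLabel])
    (fun i => by simp [relabel, ptLabel]) fun x y => ?_
  have key : ∀ x : Fin u.length ⊕ Fin v.length, ∃ z ∈ u ++ v, z.2 = ptLabel u v x := by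
    rintro (i | i)
    · exact ⟨u[i], by simp, rfl⟩
    · exact ⟨v[i], by simp, rfl⟩
  refine ofWords_rel.trans ⟨congrArg f, fun h => ?_⟩
  obtain ⟨z, hz, hz'⟩ := key x
  obtain ⟨z', hw, hw'⟩ := key y
  rw [← hz', ← hw'] at h ⊢
  exact hf _ hz _ hw h

theorem exists_ofWords (p : TCP) : ∃ (α : Type) (u v : Word α), p = ofWords u v := by
  refine ⟨Quotient p.rel, List.ofFn fun i => (p.upColor i, Quotient.mk _ (Sum.inl i)),
    List.ofFn fun j => (p.lowColor j, Quotient.mk _ (Sum.inr j)), ?_⟩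
  exact eq_ofWords (by simp) (by simp) (Quotient.mk _) (by simp) (by simp)
    fun x y => (Quotient.eq (r := p.rel)).symm

theorem tensor_ofWords (u v : Word α) (u' v' : Word β) :
    tensor (ofWords u v) (ofWords u' v') =
      ofWords (relabel Sum.inl u ++ relabel Sum.inr u') (relabel Sum.inl v ++ relabel Sum.inr v') := by
  have key : ∀ (w : Word α) (w' : Word β) (i : Fin (w.length + w'.length)),
      (relabel Sum.inl w ++ relabel Sum.inr w' : Word (α ⊕ β))[i.1]'(by simp) =
      Sum.elim (fun a => (w[a].1, Sum.inl w[a].2)) (fun b => (w'[b].1, Sum.inr w'[b].2))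
        (finSumFinEquiv.symm i) := by
    intro w w' i
    obtain ⟨j, rfl⟩ := finSumFinEquiv.surjective i
    rcases j with j | j <;> simp [relabel]
  refine eq_ofWords (k := u.length + u'.length) (l := v.length + v'.length)
    (by simp) (by simp)
    (fun x => Sum.map (ptLabel u v) (ptLabel u' v') (splitPt (ofWords u v) (ofWords u' v') x))
    (fun i => ?_) (fun i => ?_) fun x y => ?_
  · refine Eq.trans ?_ (key u u' i).symm
    change (Sum.elim (fun a : Fin u.length => u[a].1) (fun b : Fin u'.length => u'[b].1)
      (finSumFinEquiv.symm i), Sum.map (ptLabel u v) (ptLabel u' v') (Sum.elim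
        (fun a => .inl (.inl a)) (fun b => .inr (.inl b)) (finSumFinEquiv.symm i))) = _
    rcases finSumFinEquiv.symm i with j | j <;> rfl
  · refine Eq.trans ?_ (key v v' i).symm
    change (Sum.elim (fun a : Fin v.length => v[a].1) (fun b : Fin v'.length => v'[b].1)
      (finSumFinEquiv.symm i), Sum.map (ptLabel u v) (ptLabel u' v') (Sum.elim
        (fun a => .inl (.inr a)) (fun b => .inr (.inr b)) (finSumFinEquiv.symm i))) = _
    rcases finSumFinEquiv.symm i with j | j <;> rfl
  · change sumRel (ofWords u v).rel (ofWords u' v').rel _ _ ↔ _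
    rcases splitPt (ofWords u v) (ofWords u' v') x with a | a <;>
      rcases splitPt (ofWords u v) (ofWords u' v') y with b | b
    · exact ofWords_rel.trans Sum.inl_injective.eq_iff.symm
    · exact iff_of_false id Sum.inl_ne_inr
    · exact iff_of_false id Sum.inr_ne_inl
    · exact ofWords_rel.trans Sum.inr_injective.eq_iff.symm

theorem invol_ofWords (u v : Word α) : invol (ofWords u v) = ofWords v u := by
  refine TCP_ext rfl rfl (fun _ => rfl) (fun _ => rfl) ?_
  rintro (x | x) (y | y) <;> rfl

/-- Labels of the middle row that are identified in a composition. -/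
def Glue (v : Word α) (v' : Word β) (x y : α ⊕ β) : Prop :=
  ∃ z ∈ v.zip v', x = Sum.inl z.1.2 ∧ y = Sum.inr z.2.2

theorem comp_ofWords {u v : Word α} {v' w : Word β} (h : v.length = v'.length)
    (f : α → γ) (g : β → γ) (s : γ → α ⊕ β) (hfg : relabel f v = relabel g v')
    (hf : ∀ a, Relation.EqvGen (Glue v v') (Sum.inl a) (s (f a)))
    (hg : ∀ b, Relation.EqvGen (Glue v v') (Sum.inr b) (s (g b))) :
    comp (ofWords u v) (ofWords v' w) h = ofWords (relabel f u) (relabel g w) := by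
  classical
  set q := ofWords u v with hq
  set p := ofWords v' w with hp
  have hmid : ∀ i (hi : i < v.length), f (v[i].2) = g ((v'[i]'(h ▸ hi)).2) := by
    intro i hi
    have h1 : (relabel f v)[i]'(by simpa) = (relabel g v')[i]'(by simpa using h ▸ hi) := by
      simp only [hfg]
    simp only [relabel, List.getElem_map, Prod.mk.injEq] at h1
    exact h1.2
  let Carry : (Fin q.k ⊕ Fin q.l) ⊕ Fin p.l → α ⊕ β → Prop := fun t x =>
    (∃ y, t = .inl y ∧ x = .inl (ptLabel u v y)) ∨
    (∃ y, t = compEmbMid q p h y ∧ x = .inr (ptLabel v' w y))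
  have hsame : ∀ t t' x, Carry t x → Carry t' x → Relation.EqvGen (compRel q p h) t t' := by
    rintro t t' x (⟨y, rfl, rfl⟩ | ⟨y, rfl, rfl⟩) (⟨z, rfl, hz⟩ | ⟨z, rfl, hz⟩)
    · exact .rel _ _ (Or.inl ⟨y, z, Sum.inl_injective hz, rfl, rfl⟩)
    · cases hz
    · cases hz
    · exact .rel _ _ (Or.inr ⟨y, z, Sum.inr_injective hz, rfl, rfl⟩)
  have hlift : ∀ x y, Relation.EqvGen (Glue v v') x y →
      x = y ∨ ∃ t t', Carry t x ∧ Carry t' y ∧ Relation.EqvGen (compRel q p h) t t' := by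
    intro x y hxy
    induction hxy with
    | rel x y hxy =>
      obtain ⟨z, hz, rfl, rfl⟩ := hxy
      obtain ⟨i, hi, rfl⟩ := List.getElem_of_mem hz
      have hi' : i < v.length := by simp at hi; omega
      have hi'' : i < v'.length := h ▸ hi'
      refine Or.inr ⟨.inl (.inr ⟨i, hi'⟩), .inl (.inr ⟨i, hi'⟩), Or.inl ⟨.inr ⟨i, hi'⟩, rfl, ?_⟩,
        Or.inr ⟨.inl ⟨i, hi''⟩, rfl, ?_⟩, .refl _⟩
      · exact congrArg Sum.inl (congrArg Prod.snd (by simp : ((v.zip v')[i]).1 = v[i]))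
      · exact congrArg Sum.inr (congrArg Prod.snd (by simp : ((v.zip v')[i]).2 = v'[i]))
    | refl x => exact Or.inl rfl
    | symm x y _ ih =>
      rcases ih with rfl | ⟨t, t', h1, h2, h3⟩
      · exact Or.inl rfl
      · exact Or.inr ⟨t', t, h2, h1, .symm _ _ h3⟩
    | trans x y z _ _ ih1 ih2 =>
      rcases ih1 with rfl | ⟨t, t', h1, h2, h3⟩
      · exact ih2
      · rcases ih2 with rfl | ⟨s, s', k1, k2, k3⟩
        · exact Or.inr ⟨t, t', h1, h2, h3⟩
        · exact Or.inr ⟨t, s', h1, k2, .trans _ _ _ h3 (.trans _ _ _ (hsame _ _ _ h2 k1) k3)⟩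
  let L : (Fin q.k ⊕ Fin q.l) ⊕ Fin p.l → γ :=
    Sum.elim (fun y => f (ptLabel u v y)) (fun j => g (w[j].2))
  have hL : ∀ t t', Relation.EqvGen (compRel q p h) t t' → L t = L t' := by
    have hemb : ∀ y, L (compEmbMid q p h y) = g (ptLabel v' w y) := by
      rintro (i | i)
      · exact hmid i.1 (by have := i.2; rw [h]; exact this)
      · rfl
    intro t t' htt
    induction htt with
    | rel x y hxy =>
      rcases hxy with ⟨a, b, hab, rfl, rfl⟩ | ⟨a, b, hab, rfl, rfl⟩
      · exact congrArg f hab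
      · rw [hemb, hemb]; exact congrArg g hab
    | refl x => rfl
    | symm x y _ ih => exact ih.symm
    | trans x y z _ _ ih1 ih2 => exact ih1.trans ih2
  have hback : ∀ t t', L t = L t' → Relation.EqvGen (compRel q p h) t t' := by
    have hrep : ∀ t, ∃ x, Carry t x ∧ Relation.EqvGen (Glue v v') x (s (L t)) := by
      rintro (y | j)
      · exact ⟨_, Or.inl ⟨y, rfl, rfl⟩, hf _⟩
      · exact ⟨_, Or.inr ⟨.inr j, rfl, rfl⟩, hg _⟩
    intro t t' htt
    obtain ⟨x, hx, hx'⟩ := hrep t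
    obtain ⟨y, hy, hy'⟩ := hrep t'
    rw [← htt] at hy'
    rcases hlift x y (.trans _ _ _ hx' (.symm _ _ hy')) with rfl | ⟨r, r', h1, h2, h3⟩
    · exact hsame _ _ _ hx hy
    · exact .trans _ _ _ (hsame _ _ _ hx h1) (.trans _ _ _ h3 (hsame _ _ _ h2 hy))
  have hcomp : ∀ x y, (comp q p h).rel.r x y ↔
      L (Sum.elim (fun i => Sum.inl (Sum.inl i)) (fun j => Sum.inr j) x) =
      L (Sum.elim (fun i => Sum.inl (Sum.inl i)) (fun j => Sum.inr j) y) :=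
    fun x y => ⟨hL _ _, hback _ _⟩
  refine eq_ofWords (k := u.length) (l := w.length) (by simp) (by simp) _
    (fun i => ?_) (fun i => ?_) hcomp
  · exact Eq.trans rfl (by simp [relabel] : (u[i].1, f u[i].2) = (relabel f u)[i.1])
  · exact Eq.trans rfl (by simp [relabel] : (w[i].1, g w[i].2) = (relabel g w)[i.1])

end Words

section Rules
variable {α β γ : Type} {C : Set TCP}

/-- The partition on lower points given by the word `w` belongs to `C`. -/
def Mem (C : Set TCP) (w : Word α) : Prop := ofWords [] w ∈ C

/-- The list of block labels of a word. -/
def labels (w : Word α) : List α := w.map Prod.snd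

@[simp] theorem labels_nil : labels ([] : Word α) = [] := rfl

@[simp] theorem labels_cons (x : Bool × α) (w : Word α) : labels (x :: w) = x.2 :: labels w := rfl

@[simp] theorem labels_append (u v : Word α) : labels (u ++ v) = labels u ++ labels v := by
  simp [labels]

@[simp] theorem labels_bar (w : Word α) : labels (bar w) = (labels w).reverse := by
  induction w with
  | nil => rfl
  | cons x w ih => simp [ih]

@[simp] theorem labels_relabel (f : α → β) (w : Word α) : labels (relabel f w) = (labels w).map f := by
  simp [labels, relabel]

theorem mem_labels {w : Word α} {x : Bool × α} (h : x ∈ w) : x.2 ∈ labels w :=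
  List.mem_map_of_mem h

/-- The word `w` with pairwise different labels. -/
def separate (w : Word α) : Word (Fin w.length) := List.ofFn fun i => (w[i].1, i)

@[simp] theorem length_separate (w : Word α) : (separate w).length = w.length := by
  simp [separate]

theorem relabel_separate (w : Word α) : relabel (fun i : Fin w.length => w[i].2) (separate w) = w := by
  refine List.ext_getElem (by simp) ?_
  intro i h1 h2
  simp [relabel, separate]

theorem mem_separate (w : Word α) (i : Fin w.length) : (w[i].1, i) ∈ separate w := by
  simp only [separate, List.mem_ofFn]
  exact ⟨i, rfl⟩

theorem colorsMatch_of_relabel {u v : Word α} {v' w : Word β} (h : v.length = v'.length)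
    {f : α → γ} {g : β → γ} (hfg : relabel f v = relabel g v') :
    ColorsMatch (ofWords u v) (ofWords v' w) h := by
  intro j
  have h1 : ((relabel f v)[j.1]'(by have := j.2; rw [length_relabel]; exact this)).1 =
      ((relabel g v')[j.1]'(by have := j.2; rw [length_relabel]; exact h ▸ this)).1 := by
    simp only [hfg]
  simp only [relabel, List.getElem_map] at h1
  exact h1

theorem glue_relabel {s : Word α} {δ ε : Type} (j : α → δ) (j' : α → ε) {c : Bool} {a : α}
    (h : (c, a) ∈ s) : Glue (relabel j s) (relabel j' s) (Sum.inl (j a)) (Sum.inr (j' a)) := by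
  obtain ⟨i, hi, h⟩ := List.getElem_of_mem h
  refine ⟨((c, j a), (c, j' a)), ?_, rfl, rfl⟩
  rw [List.mem_iff_getElem]
  exact ⟨i, by simpa, by simp [relabel, h]⟩

theorem Glue.append_right {v : Word α} {v' : Word β} {x y : α ⊕ β} (h : Glue v v' x y)
    (hl : v.length = v'.length) (t : Word α) (t' : Word β) : Glue (v ++ t) (v' ++ t') x y := by
  obtain ⟨z, hz, h⟩ := h
  exact ⟨z, by rw [List.zip_append hl]; exact List.mem_append_left _ hz, h⟩

theorem Glue.append_left {v : Word α} {v' : Word β} {x y : α ⊕ β} (h : Glue v v' x y)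
    {t : Word α} {t' : Word β} (hl : t.length = t'.length) : Glue (t ++ v) (t' ++ v') x y := by
  obtain ⟨z, hz, h⟩ := h
  exact ⟨z, by rw [List.zip_append hl]; exact List.mem_append_right _ hz, h⟩

theorem mem_bar {w : Word α} {c : Bool} {a : α} (h : (c, a) ∈ w) : (!c, a) ∈ bar w := by
  simp only [bar, List.mem_reverse, List.mem_map]
  exact ⟨_, h, rfl⟩

namespace IsCategory

theorem comp_ofWords_mem (hC : IsCategory C) {u v : Word α} {v' w : Word β}
    (hq : ofWords u v ∈ C) (hp : ofWords v' w ∈ C)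
    (f : α → γ) (g : β → γ) (s : γ → α ⊕ β) (hfg : relabel f v = relabel g v')
    (hf : ∀ a, Relation.EqvGen (Glue v v') (Sum.inl a) (s (f a)))
    (hg : ∀ b, Relation.EqvGen (Glue v v') (Sum.inr b) (s (g b))) :
    ofWords (relabel f u) (relabel g w) ∈ C := by
  have h : v.length = v'.length := by simpa using congrArg List.length hfg
  rw [← comp_ofWords h f g s hfg hf hg]
  exact hC.comp_mem _ hq _ hp h (colorsMatch_of_relabel h hfg)

theorem tensor_ofWords_mem (hC : IsCategory C) {u v : Word α} {u' v' : Word β}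
    (hp : ofWords u v ∈ C) (hq : ofWords u' v' ∈ C) :
    ofWords (relabel Sum.inl u ++ relabel Sum.inr u') (relabel Sum.inl v ++ relabel Sum.inr v') ∈ C :=
  tensor_ofWords u v u' v' ▸ hC.tensor_mem _ hp _ hq

theorem mem_pair (hC : IsCategory C) (c : Bool) (a : α) : Mem C [(c, a), (!c, a)] := by
  have h : ofWords [] [(c, a), (!c, a)] = pairLower c (!c) := by
    refine TCP_ext rfl rfl (fun i => i.elim0) (fun i => ?_) fun x y => ?_
    · change Fin 2 at i
      fin_cases i <;> rfl
    · rcases x with x | x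
      · exact x.elim0
      rcases y with y | y
      · exact y.elim0
      change Fin 2 at x y
      refine iff_of_true ?_ rfl
      fin_cases x <;> fin_cases y <;> rfl
  rw [Mem, h]
  cases c
  · exact hC.pairbw_mem
  · exact hC.pairwb_mem

theorem id_mem (hC : IsCategory C) (c : Bool) : ofWords [(c, ())] [(c, ())] ∈ C := by
  have h : ofWords [(c, ())] [(c, ())] = idPart c := by
    refine TCP_ext rfl rfl (fun i => ?_) (fun i => ?_) fun x y => ?_
    · change Fin 1 at i
      fin_cases i; rfl
    · change Fin 1 at i
      fin_cases i; rfl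
    · exact iff_of_true rfl trivial
  rw [h]
  cases c
  · exact hC.idb_mem
  · exact hC.idw_mem

theorem mem_nil (hC : IsCategory C) : Mem C ([] : Word α) := by
  have h1 := hC.mem_pair true ()
  have h2 := hC.invol_mem _ h1
  rw [invol_ofWords] at h2
  have := hC.comp_ofWords_mem (γ := Unit) h1 h2 id id Sum.inl rfl (fun _ => .refl _) fun _ =>
    .symm _ _ (.rel _ _ ⟨((true, ()), (true, ())), by simp, rfl, rfl⟩)
  have h : ofWords ([] : Word α) [] = ofWords ([] : Word Unit) [] :=
    TCP_ext rfl rfl (fun i => i.elim0) (fun i => i.elim0) (by rintro (x | x) <;> exact x.elim0)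
  rw [Mem, h]
  exact this

theorem separate_ofWords_mem (hC : IsCategory C) (w : Word α) :
    ofWords (separate w) (separate w) ∈ C := by
  induction w with
  | nil => exact hC.mem_nil
  | cons x w ih =>
    have h := hC.tensor_ofWords_mem (hC.id_mem x.1) ih
    rw [ofWords_relabel (f := Sum.elim (fun _ => (0 : Fin (w.length + 1))) Fin.succ)] at h
    · convert h using 1
      have : separate (x :: w) = relabel (Sum.elim (fun _ => (0 : Fin (w.length + 1))) Fin.succ)
          (relabel Sum.inl [(x.1, ())] ++ relabel Sum.inr (separate w)) := by
        simp [separate, relabel, List.ofFn_succ, List.map_ofFn, Function.comp_def]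
      rw [this]
    · intro x _ y _ hxy
      rcases x with ⟨_, x | x⟩ <;> rcases y with ⟨_, y | y⟩ <;>
        simp_all [Fin.succ_ne_zero, (Fin.succ_ne_zero _).symm]

theorem exists_separate (hC : IsCategory C) (w : Word α) :
    ∃ (n : ℕ) (W : Word (Fin n)) (f : Fin n → α),
      w = relabel f W ∧ ofWords W W ∈ C ∧ (∀ i, ∃ c, (c, i) ∈ W) ∧ (labels W).Nodup := by
  refine ⟨_, _, _, (relabel_separate w).symm, hC.separate_ofWords_mem w,
    fun i => ⟨_, mem_separate w i⟩, ?_⟩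
  simp [separate, labels, List.map_ofFn, Function.comp_def, List.nodup_ofFn, Function.Injective]

theorem mem_contract [DecidableEq α] (hC : IsCategory C) {u v : Word α} {c : Bool} {a b : α}
    (h : Mem C (u ++ (c, a) :: (!c, b) :: v)) :
    Mem C (relabel (fun x => if x = b then a else x) (u ++ v)) := by
  have h1 := hC.invol_mem _ (hC.mem_pair c ())
  rw [invol_ofWords] at h1
  obtain ⟨m, U, fu, rfl, hU, hU', -⟩ := hC.exists_separate u
  obtain ⟨n, V, fv, rfl, hV, hV', -⟩ := hC.exists_separate v
  have h2 := hC.tensor_ofWords_mem (hC.tensor_ofWords_mem hU h1) hV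
  set f : α → α := fun x => if x = b then a else x with hf
  have hab : f a = a := by simp [hf]
  have hbb : f b = a := by simp [hf]
  have key := hC.comp_ofWords_mem h h2 f
    (Sum.elim (Sum.elim (f ∘ fu) (fun _ => a)) (f ∘ fv)) Sum.inl
  simp only [relabel_append, relabel_relabel, relabel_cons, relabel_nil, List.append_nil,
    Function.comp_def, Sum.elim_inl, Sum.elim_inr] at key
  simp only [Mem, relabel_append, relabel_relabel, Function.comp_def]
  set R := Glue (relabel fu U ++ (c, a) :: (!c, b) :: relabel fv V)
    (relabel (fun x => (Sum.inl (Sum.inl x) : (Fin m ⊕ Unit) ⊕ Fin n)) U ++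
      [(c, Sum.inl (Sum.inr ())), (!c, Sum.inl (Sum.inr ()))] ++
      relabel (fun x => Sum.inr x) V) with hR
  have g1 : R (Sum.inl a) (Sum.inr (Sum.inl (Sum.inr ()))) := by
    rw [hR, List.append_assoc]
    exact Glue.append_left ⟨((c, a), (c, _)), by simp, rfl, rfl⟩ (by simp)
  have g2 : R (Sum.inl b) (Sum.inr (Sum.inl (Sum.inr ()))) := by
    rw [hR, List.append_assoc]
    exact Glue.append_left ⟨((!c, b), (!c, _)), by simp, rfl, rfl⟩ (by simp)
  have g3 : ∀ x, Relation.EqvGen R (Sum.inl x) (Sum.inl (f x)) := by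
    intro x
    by_cases hx : x = b
    · subst hx
      rw [hbb]
      exact .trans _ _ _ (.rel _ _ g2) (.symm _ _ (.rel _ _ g1))
    · simp only [hf, hx, if_false]
      exact .refl _
  refine key (by simp [hab, hbb]) g3 ?_
  rintro ((i | i) | i)
  · obtain ⟨c', hc'⟩ := hU' i
    refine .trans _ _ _ (.symm _ _ (.rel _ _ ?_)) (g3 (fu i))
    rw [hR, List.append_assoc]
    exact (glue_relabel _ _ hc').append_right (by simp) _ _
  · exact .symm _ _ (.rel _ _ g1)
  · obtain ⟨c', hc'⟩ := hV' i
    refine .trans _ _ _ (.symm _ _ (.rel _ _ ?_)) (g3 (fv i))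
    rw [hR, List.append_assoc]
    exact Glue.append_left (Glue.append_left (t := [(c, a), (!c, b)])
      (glue_relabel _ _ hc') (by simp)) (by simp)

theorem mem_insert (hC : IsCategory C) {u v : Word α} {t : Word β} (h : Mem C (u ++ v))
    (ht : Mem C t) :
    Mem C (relabel Sum.inl u ++ relabel Sum.inr t ++ relabel Sum.inl v : Word (α ⊕ β)) := by
  obtain ⟨m, U, fu, rfl, hU, hU', -⟩ := hC.exists_separate u
  obtain ⟨n, V, fv, rfl, hV, hV', -⟩ := hC.exists_separate v
  have h2 := hC.tensor_ofWords_mem (hC.tensor_ofWords_mem hU ht) hV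
  have key := hC.comp_ofWords_mem h h2 (Sum.inl : α → α ⊕ β)
    (Sum.elim (Sum.elim (Sum.inl ∘ fu) Sum.inr) (Sum.inl ∘ fv))
    (Sum.elim Sum.inl (Sum.inr ∘ Sum.inl ∘ Sum.inr))
  simp only [relabel_append, relabel_relabel, relabel_nil, List.append_nil,
    Function.comp_def, Sum.elim_inl, Sum.elim_inr] at key
  simp only [Mem, relabel_relabel, Function.comp_def]
  refine key trivial (fun _ => .refl _) ?_
  rintro ((i | i) | i)
  · obtain ⟨c', hc'⟩ := hU' i
    exact .symm _ _ (.rel _ _ ((glue_relabel _ _ hc').append_right (by simp) _ _))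
  · exact .refl _
  · obtain ⟨c', hc'⟩ := hV' i
    exact .symm _ _ (.rel _ _ (Glue.append_left (glue_relabel _ _ hc') (by simp)))

theorem mem_relabel (f : α → β) {w : Word α}
    (hf : ∀ x ∈ w, ∀ y ∈ w, f x.2 = f y.2 → x.2 = y.2) : Mem C (relabel f w) ↔ Mem C w := by
  have := ofWords_relabel (u := []) (v := w) (f := f) (by simpa using hf)
  rw [Mem, Mem, this]
  rfl

theorem mem_relabel_injective {f : α → β} (hf : Function.Injective f) {w : Word α} :
    Mem C (relabel f w) ↔ Mem C w :=
  mem_relabel f fun _ _ _ _ h => hf h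

theorem mem_rotate (hC : IsCategory C) {u v : Word α} (h : Mem C (u ++ v)) : Mem C (v ++ u) := by
  classical
  induction u generalizing v with
  | nil => simpa using h
  | cons x u ih =>
    obtain ⟨c, a⟩ := x
    have h1 := hC.mem_insert (u := [(!c, ())]) (v := [(c, ())])
      (by simpa using hC.mem_pair (!c) ()) h
    have h2 := hC.mem_contract (u := []) (c := !c) (a := Sum.inl ()) (b := Sum.inr a)
      (v := relabel Sum.inr (u ++ v) ++ [(c, Sum.inl ())]) (by simpa using h1)
    have h3 : Mem C (u ++ (v ++ [(c, a)])) := by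
      rw [← mem_relabel_injective (C := C)
        (f := fun x => if x = a then (Sum.inl () : Unit ⊕ α) else Sum.inr x)]
      · convert h2 using 1
        simp [Function.comp_def]
      · intro x y hxy
        by_cases hx : x = a <;> by_cases hy : y = a <;> simp_all
    simpa using ih h3

theorem mem_insert_of_disjoint (hC : IsCategory C) {u v t : Word α} (h : Mem C (u ++ v))
    (ht : Mem C t) (hd : ∀ a ∈ labels t, a ∉ labels (u ++ v)) : Mem C (u ++ t ++ v) := by
  have h1 := hC.mem_insert h ht
  rw [← mem_relabel (C := C) (f := Sum.elim id id)] at h1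
  · simpa [Function.comp_def, relabel] using h1
  · intro x hx y hy hxy
    have key : ∀ z ∈ (relabel Sum.inl u ++ relabel Sum.inr t ++ relabel Sum.inl v : Word (α ⊕ α)),
        (∃ a ∈ labels (u ++ v), z.2 = Sum.inl a) ∨ (∃ a ∈ labels t, z.2 = Sum.inr a) := by
      intro z hz
      have := mem_labels hz
      simp only [labels_append, labels_relabel, List.mem_append, List.mem_map] at this ⊢
      rcases this with (⟨a, h1, h2⟩ | ⟨a, h1, h2⟩) | ⟨a, h1, h2⟩
      · exact Or.inl ⟨a, Or.inl h1, h2.symm⟩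
      · exact Or.inr ⟨a, h1, h2.symm⟩
      · exact Or.inl ⟨a, Or.inr h1, h2.symm⟩
    rcases key x hx with ⟨a, ha, hx⟩ | ⟨a, ha, hx⟩ <;>
      rcases key y hy with ⟨b, hb, hy⟩ | ⟨b, hb, hy⟩ <;>
      rw [hx, hy] at hxy ⊢ <;> simp only [Sum.elim_inl, Sum.elim_inr, id] at hxy <;> subst hxy
    · rfl
    · exact absurd ha (hd _ hb)
    · exact absurd hb (hd _ ha)
    · rfl

theorem mem_nestedPairs (hC : IsCategory C) (U : Word α) (hU : (labels U).Nodup) :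
    Mem C (bar U ++ U) := by
  induction U with
  | nil => exact hC.mem_nil
  | cons x U ih =>
    obtain ⟨c, a⟩ := x
    simp only [labels_cons, List.nodup_cons] at hU
    have h1 := hC.mem_insert_of_disjoint (ih hU.2) (hC.mem_pair (!c) a) (by simpa using hU.1)
    simpa using h1

theorem ofWords_self_mem (hC : IsCategory C) (U : Word α) (hU : (labels U).Nodup) :
    ofWords U U ∈ C := by
  have h := hC.separate_ofWords_mem U
  rw [ofWords_relabel (f := fun i : Fin U.length => U[i].2), relabel_separate] at h
  · exact h
  · intro x _ y _ hxy
    have := List.nodup_iff_injective_getElem.1 hU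
    have key : (⟨x.2.1, by simp [labels]⟩ : Fin (labels U).length) =
        ⟨y.2.1, by simp [labels]⟩ := this (by simpa [labels] using hxy)
    simpa [Fin.ext_iff] using key

theorem mem_ofWords_iff (hC : IsCategory C) {u v : Word α} :
    ofWords u v ∈ C ↔ Mem C (bar u ++ v) := by
  obtain ⟨m, U, fu, rfl, hU, hU', hUn⟩ := hC.exists_separate u
  constructor
  · intro h
    have h1 := hC.tensor_ofWords_mem (hC.ofWords_self_mem (bar U) (by simpa using hUn)) h
    have key := hC.comp_ofWords_mem (hC.mem_nestedPairs U hUn) h1 fu (Sum.elim fu id)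
      (Sum.inr ∘ Sum.inr)
    simp only [relabel_append, relabel_relabel, relabel_nil, Sum.elim_comp_inl, Sum.elim_comp_inr,
      relabel_id, relabel_bar] at key ⊢
    have g : ∀ i, Relation.EqvGen (Glue (bar U ++ U)
        (bar (relabel (Sum.inl : _ → Fin m ⊕ α) U) ++ relabel (Sum.inr ∘ fu) U))
        (Sum.inl i) (Sum.inr (Sum.inr (fu i))) := by
      intro i
      obtain ⟨c', hc'⟩ := hU' i
      have := glue_relabel id (Sum.inr ∘ fu : _ → Fin m ⊕ α) hc'
      rw [relabel_id] at this
      exact .rel _ _ (Glue.append_left this (by simp))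
    refine key rfl g ?_
    rintro (i | a)
    · refine .trans _ _ _ (.symm _ _ (.rel _ _ ?_)) (g i)
      obtain ⟨c', hc'⟩ := hU' i
      have := glue_relabel id (Sum.inl : _ → Fin m ⊕ α) (mem_bar hc')
      rw [relabel_id, relabel_bar] at this
      exact Glue.append_right this (by simp) _ _
    · exact .refl _
  · intro h
    obtain ⟨n, V, fv, rfl, hV, hV', -⟩ := hC.exists_separate v
    have h1 := hC.tensor_ofWords_mem hU h
    have h2 := hC.invol_mem _ (hC.mem_nestedPairs (bar U) (by simpa using hUn))
    rw [invol_ofWords, bar_bar] at h2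
    have h3 := hC.tensor_ofWords_mem h2 hV
    have key := hC.comp_ofWords_mem h1 h3 (Sum.elim fu id) (Sum.elim fu fv)
      (Sum.inl ∘ Sum.inr)
    simp only [relabel_append, relabel_relabel, relabel_nil, Sum.elim_comp_inl, Sum.elim_comp_inr,
      relabel_bar, List.append_nil, List.nil_append, List.append_assoc,
      ← Function.comp_assoc, Function.id_comp] at key ⊢
    have g : ∀ i c, (c, i) ∈ U → Glue (relabel (Sum.inl : _ → Fin m ⊕ α) U ++
          (bar (relabel (Sum.inr ∘ fu) U) ++ relabel (Sum.inr ∘ fv) V))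
        (relabel (Sum.inl : _ → Fin m ⊕ Fin n) U ++ (bar (relabel Sum.inl U) ++ relabel Sum.inr V))
        (Sum.inl (Sum.inr (fu i))) (Sum.inr (Sum.inl i)) := by
      intro i c' hc'
      have := glue_relabel (Sum.inr ∘ fu : _ → Fin m ⊕ α) (Sum.inl : _ → Fin m ⊕ Fin n) (mem_bar hc')
      rw [relabel_bar, relabel_bar] at this
      exact Glue.append_left (Glue.append_right this (by simp) _ _) (by simp)
    refine key trivial ?_ ?_
    · rintro (i | a)
      · obtain ⟨c', hc'⟩ := hU' i
        refine .trans _ _ _ (.rel _ _ ?_) (.symm _ _ (.rel _ _ (g i c' hc')))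
        exact (glue_relabel _ _ hc').append_right (by simp) _ _
      · exact .refl _
    · rintro (i | i)
      · obtain ⟨c', hc'⟩ := hU' i
        exact .symm _ _ (.rel _ _ (g i c' hc'))
      · obtain ⟨c', hc'⟩ := hV' i
        refine .symm _ _ (.rel _ _ ?_)
        exact Glue.append_left (Glue.append_left
          (glue_relabel (Sum.inr ∘ fv : _ → Fin m ⊕ α) (Sum.inr : _ → Fin m ⊕ Fin n) hc')
            (by simp)) (by simp)

theorem mem_bar_of_mem (hC : IsCategory C) {w : Word α} (h : Mem C w) : Mem C (bar w) := by
  have h1 := hC.invol_mem _ h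
  rw [invol_ofWords, hC.mem_ofWords_iff, List.append_nil] at h1
  exact h1

end IsCategory
end Rules

section Merging
variable {α β γ : Type} {C : Set TCP}

/-- The renaming that replaces the label `b` by `a`. -/
def fuse [DecidableEq α] (a b x : α) : α := if x = b then a else x

@[simp] theorem fuse_left [DecidableEq α] (a b : α) : fuse a b a = a := by simp [fuse]

@[simp] theorem fuse_right [DecidableEq α] (a b : α) : fuse a b b = a := by simp [fuse]

theorem fuse_of_ne [DecidableEq α] (a : α) {b x : α} (h : x ≠ b) : fuse a b x = x := by
  simp [fuse, h]

theorem fuse_self [DecidableEq α] (a : α) : fuse a a = id := by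
  funext x
  by_cases h : x = a <;> simp [fuse, h]

theorem relabel_eq_self {f : α → α} {w : Word α} (h : ∀ a ∈ labels w, f a = a) : relabel f w = w :=
  (relabel_congr (g := id) fun _ hx => h _ (mem_labels hx)).trans (relabel_id w)

/-- The word with colors `cs` consisting of a single block labelled `a`. -/
def blk (cs : List Bool) (a : α) : Word α := cs.map fun c => (c, a)

@[simp] theorem blk_nil (a : α) : blk [] a = [] := rfl

@[simp] theorem blk_cons (c : Bool) (cs : List Bool) (a : α) :
    blk (c :: cs) a = (c, a) :: blk cs a := rfl

@[simp] theorem blk_append (cs ds : List Bool) (a : α) : blk (cs ++ ds) a = blk cs a ++ blk ds a := by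
  simp [blk]

@[simp] theorem relabel_blk (f : α → β) (cs : List Bool) (a : α) :
    relabel f (blk cs a) = blk cs (f a) := by simp [relabel, blk]

theorem eq_of_mem_labels_blk {cs : List Bool} {a b : α} (h : b ∈ labels (blk cs a)) : b = a := by
  simp only [labels, blk, List.map_map, List.mem_map] at h
  obtain ⟨_, _, rfl⟩ := h
  rfl

/-- Reversal and inversion of a list of colors. -/
def cbar (cs : List Bool) : List Bool := (cs.map not).reverse

theorem bar_blk (cs : List Bool) (a : α) : bar (blk cs a) = blk (cbar cs) a := by
  simp [bar, blk, cbar, Function.comp_def]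

/-- The colors of a word. -/
def colors (w : Word α) : List Bool := w.map Prod.fst

@[simp] theorem colors_nil : colors ([] : Word α) = [] := rfl

@[simp] theorem colors_cons (x : Bool × α) (w : Word α) : colors (x :: w) = x.1 :: colors w := rfl

@[simp] theorem colors_append (u v : Word α) : colors (u ++ v) = colors u ++ colors v := by
  simp [colors]

@[simp] theorem colors_relabel (f : α → β) (w : Word α) : colors (relabel f w) = colors w := by
  simp [colors, relabel]

@[simp] theorem colors_blk (cs : List Bool) (a : α) : colors (blk cs a) = cs := by
  simp [colors, blk, Function.comp_def]

@[simp] theorem colors_bar (w : Word α) : colors (bar w) = cbar (colors w) := by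
  simp [colors, bar, cbar, Function.comp_def]

/-- The one-block partition with lower colors `cs` belongs to `C`. -/
def MemBlk (C : Set TCP) (cs : List Bool) : Prop := Mem C (blk cs ())

theorem mem_blk_iff {cs : List Bool} {a : α} : Mem C (blk cs a) ↔ MemBlk C cs := by
  have := IsCategory.mem_relabel (C := C) (f := fun _ => ()) (w := blk cs a) ?_
  · rw [← this, relabel_blk]; rfl
  · intro x hx y hy _
    rw [eq_of_mem_labels_blk (mem_labels hx), eq_of_mem_labels_blk (mem_labels hy)]

namespace IsCategory

theorem mem_contract_fuse [DecidableEq α] (hC : IsCategory C) {u v : Word α} {c : Bool} {a b : α}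
    (h : Mem C (u ++ (c, a) :: (!c, b) :: v)) : Mem C (relabel (fuse a b) (u ++ v)) :=
  hC.mem_contract h

theorem mem_contract_self (hC : IsCategory C) {u v : Word α} {c : Bool} {a : α}
    (h : Mem C (u ++ (c, a) :: (!c, a) :: v)) : Mem C (u ++ v) := by
  classical
  simpa [fuse_self] using hC.mem_contract_fuse h

theorem mem_cancel (hC : IsCategory C) {u v : Word α} (w : Word α)
    (h : Mem C (u ++ (w ++ bar w) ++ v)) : Mem C (u ++ v) := by
  induction w using List.reverseRecOn generalizing u v with
  | nil => simpa using h
  | append_singleton w x ih =>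
    refine ih ?_
    have := hC.mem_contract_self (u := u ++ w) (v := bar w ++ v) (c := x.1) (a := x.2)
      (by simpa using h)
    simpa using this

theorem memBlk_rotate (hC : IsCategory C) {cs ds : List Bool} (h : MemBlk C (cs ++ ds)) :
    MemBlk C (ds ++ cs) := by
  have := hC.mem_rotate (u := blk cs ()) (v := blk ds ()) (by simpa [MemBlk] using h)
  simpa [MemBlk] using this

theorem memBlk_cbar (hC : IsCategory C) {cs : List Bool} (h : MemBlk C cs) :
    MemBlk C (cbar cs) := by
  have := hC.mem_bar_of_mem h
  rwa [bar_blk] at this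

/-- A point may be replaced by the remainder of a block starting with its opposite color. -/
theorem mem_replace_point (hC : IsCategory C) {u v : Word α} {c : Bool} {a : α} {ds : List Bool}
    (h : Mem C (u ++ (c, a) :: v)) (hb : MemBlk C ((!c) :: ds)) :
    Mem C (u ++ blk ds a ++ v) := by
  classical
  have h1 := hC.mem_insert (u := u ++ [(c, a)]) (v := v) (by simpa using h) hb
  have h2 := hC.mem_contract_fuse (u := relabel Sum.inl u) (c := c) (a := Sum.inl a)
    (b := Sum.inr ()) (v := blk ds (Sum.inr ()) ++ relabel Sum.inl v) (by simpa using h1)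
  rw [← mem_relabel_injective (C := C) (f := (Sum.inl : α → α ⊕ Unit)) Sum.inl_injective]
  convert h2 using 1
  have : ∀ w : Word α, relabel (fuse (Sum.inl a) (Sum.inr ()) ∘ Sum.inl) w =
      relabel (Sum.inl : α → α ⊕ Unit) w := fun w =>
    relabel_congr fun x _ => fuse_of_ne _ (by simp)
  simp [this]

/-- Neighboring points of colors `c` and `d` may be joined. -/
theorem mem_merge [DecidableEq α] (hC : IsCategory C) {u v : Word α} {c d : Bool} {a b : α}
    (hb : MemBlk C [!c, c, d, !d]) (h : Mem C (u ++ (c, a) :: (d, b) :: v)) :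
    Mem C (relabel (fuse a b) (u ++ (c, a) :: (d, b) :: v)) := by
  have h1 := hC.mem_replace_point h hb
  have h2 := hC.mem_contract_fuse (u := u ++ [(c, a), (d, a)]) (c := !d) (a := a) (b := b)
    (v := v) (by simpa using h1)
  simpa using h2

theorem mem_selfglue [DecidableEq α] (hC : IsCategory C) {s t : Word α} (h : Mem C (s ++ t)) :
    Mem C (relabel Sum.inl s ++
      bar (relabel (fun a => if a ∈ labels t then Sum.inl a else Sum.inr a) s) : Word (α ⊕ α)) := by
  have key : ∀ (t : Word α) (T : List α),
      Mem C (relabel Sum.inl s ++ relabel Sum.inl t ++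
        bar (relabel (fun a => if a ∈ T then Sum.inl a else Sum.inr a) t) ++
        bar (relabel (fun a => if a ∈ T then Sum.inl a else Sum.inr a) s) : Word (α ⊕ α)) →
      Mem C (relabel Sum.inl s ++
        bar (relabel (fun a => if a ∈ T ++ labels t then Sum.inl a else Sum.inr a) s) :
          Word (α ⊕ α)) := by
    intro t
    induction t using List.reverseRecOn with
    | nil => intro T h; simpa using h
    | append_singleton t x ih =>
      obtain ⟨c, a⟩ := x
      intro T h
      have hg : ∀ w : Word α, relabel (fuse (Sum.inl a) (if a ∈ T then Sum.inl a else Sum.inr a))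
          (relabel (fun a => if a ∈ T then Sum.inl a else Sum.inr a) w) =
          relabel (fun y => if y ∈ a :: T then Sum.inl y else Sum.inr y : α → α ⊕ α) w := by
        intro w
        rw [relabel_relabel]
        refine relabel_congr fun y _ => ?_
        by_cases hy : y.2 = a <;> by_cases ha : a ∈ T <;> by_cases hyT : y.2 ∈ T <;>
          simp_all [fuse]
      have hl : ∀ w : Word α, relabel (fuse (Sum.inl a) (if a ∈ T then Sum.inl a else Sum.inr a))
          (relabel Sum.inl w) = (relabel Sum.inl w : Word (α ⊕ α)) := by
        intro w
        rw [relabel_relabel]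
        refine relabel_congr fun y _ => ?_
        by_cases ha : a ∈ T <;> simp_all [fuse]
      have h1 := hC.mem_contract_fuse (u := relabel Sum.inl s ++ relabel Sum.inl t) (c := c)
        (a := Sum.inl a) (b := if a ∈ T then Sum.inl a else Sum.inr a)
        (v := bar (relabel (fun a => if a ∈ T then Sum.inl a else Sum.inr a) t) ++
        bar (relabel (fun a => if a ∈ T then Sum.inl a else Sum.inr a) s)) (by simpa using h)
      simp only [relabel_append, relabel_bar, hg, hl] at h1
      have h2 := ih (a :: T) (by simpa using h1)
      convert h2 using 3
      refine relabel_congr fun y _ => ?_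
      have : (y.2 ∈ T ++ labels (t ++ [(c, a)])) ↔ y.2 ∈ a :: T ++ labels t := by
        simp
        tauto
      simp only [this]
  have h1 := hC.mem_insert (u := s ++ t) (v := []) (by simpa using h) (hC.mem_bar_of_mem h)
  have h2 := key t [] (by simpa using h1)
  simpa using h2

theorem mem_tensor_bar_of_disjoint (hC : IsCategory C) {s t : Word α} (h : Mem C (s ++ t))
    (hd : ∀ a ∈ labels s, a ∉ labels t) :
    Mem C (relabel Sum.inl s ++ bar (relabel Sum.inr s) : Word (α ⊕ α)) := by
  classical
  convert hC.mem_selfglue h using 3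
  exact relabel_congr fun x hx => (if_neg (hd _ (mem_labels hx))).symm

end IsCategory
end Merging

section Noncrossing
variable {α : Type} {C : Set TCP}

/-- The labels of a noncrossing word. -/
def NCW (w : Word α) : Prop := ∀ a b, [a, b, a, b].Sublist (labels w) → a = b

theorem ncw_of_mem (hNC : ∀ p ∈ C, Noncrossing p) {w : Word α} (h : Mem C w) : NCW w := by
  intro a b hs
  obtain ⟨f, hf⟩ := List.sublist_iff_exists_fin_orderEmbedding_get_eq.1 hs
  have hlen : (labels w).length = w.length := by simp [labels]
  let g : Fin 4 → Fin w.length := fun i => Fin.cast hlen (f i)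
  have hg : ∀ i j : Fin 4, i < j → (g i).1 < (g j).1 := fun i j hij => f.strictMono hij
  have hl : ∀ i : Fin 4, w[(g i).1].2 = [a, b, a, b].get i := by
    intro i
    rw [hf i]
    simp only [labels, g, List.get_eq_getElem, List.getElem_map]
    rfl
  have := hNC _ h (Sum.inr (g 0)) (Sum.inr (g 1)) (Sum.inr (g 2)) (Sum.inr (g 3))
    (Nat.add_lt_add_left (hg 0 1 (by decide)) _) (Nat.add_lt_add_left (hg 1 2 (by decide)) _)
    (Nat.add_lt_add_left (hg 2 3 (by decide)) _) ((hl 0).trans (hl 2).symm)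
    ((hl 1).trans (hl 3).symm)
  exact (hl 0).symm.trans (Eq.trans this (hl 1))

theorem exists_append_of_mem_labels {w : Word α} {a : α} (h : a ∈ labels w) :
    ∃ X d Y, w = X ++ (d, a) :: Y ∧ a ∉ labels X := by
  classical
  induction w with
  | nil => simp at h
  | cons x w ih =>
    by_cases hx : x.2 = a
    · exact ⟨[], x.1, w, by simp [← hx], by simp⟩
    · obtain ⟨X, d, Y, rfl, hX⟩ := ih (by simpa [Ne.symm hx] using h)
      exact ⟨x :: X, d, Y, rfl, by simp [hX, Ne.symm hx]⟩

theorem ncw_of_sublist {w w' : Word α} (h : NCW w) (hs : (labels w').Sublist (labels w)) : NCW w' :=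
  fun a b hab => h a b (hab.trans hs)

theorem not_mem_labels_of_ncw {u v Y : Word α} {cs : List Bool} {c d : Bool} {a b : α} (hab : a ≠ b)
    (hcs : cs ≠ []) (hw : NCW ((c, a) :: (u ++ blk cs b ++ v) ++ (d, a) :: Y)) :
    b ∉ labels Y := by
  intro hY
  refine hab (hw a b ?_)
  obtain ⟨c', cs, rfl⟩ := List.exists_cons_of_ne_nil hcs
  simp only [labels_cons, labels_append, blk_cons, List.append_assoc, List.cons_append]
  refine List.Sublist.cons_cons _ (.trans (.cons_cons _ ?_) (List.sublist_append_right _ _))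
  refine .trans (.trans (.cons_cons _ ?_) (List.sublist_append_right _ _))
    (List.sublist_append_right _ _)
  simpa using hY

/-- A nonempty noncrossing word has a block that is an interval. -/
theorem exists_interval_block {w : Word α} (hw : NCW w) (hne : w ≠ []) :
    ∃ u cs b v, w = u ++ blk cs b ++ v ∧ cs ≠ [] ∧ b ∉ labels u ∧ b ∉ labels v := by
  induction hn : w.length using Nat.strong_induction_on generalizing w with
  | _ n ih =>
  subst hn
  obtain ⟨⟨c, a⟩, w, rfl⟩ := List.exists_cons_of_ne_nil hne
  by_cases ha : a ∈ labels w
  · obtain ⟨X, d, Y, rfl, hX⟩ := exists_append_of_mem_labels ha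
    by_cases hX0 : X = []
    · subst hX0
      obtain ⟨u, cs, b, v, h, hcs, hu, hv⟩ := ih _ (by simp) (w := (d, a) :: Y)
        (ncw_of_sublist hw (by simp)) (by simp) rfl
      by_cases hab : b = a
      · subst hab
        have : u = [] := by
          rcases u with _ | ⟨x, u⟩
          · rfl
          · simp only [List.cons_append, List.cons.injEq] at h
            simp [← h.1] at hu
        subst this
        exact ⟨[], c :: cs, b, v, by simpa using h, by simp, hu, hv⟩
      · exact ⟨(c, a) :: u, cs, b, v, by simpa using h, hcs, by simp [hab, hu], hv⟩
    · obtain ⟨u, cs, b, v, rfl, hcs, hu, hv⟩ := ih _ (by simp) (w := X)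
        (ncw_of_sublist hw (by simp)) hX0 rfl
      have hba : a ≠ b := by
        rintro rfl
        obtain ⟨c', cs, rfl⟩ := List.exists_cons_of_ne_nil hcs
        simp at hX
      refine ⟨(c, a) :: u, cs, b, v ++ (d, a) :: Y, by simp, hcs, by simp [hba.symm, hu], ?_⟩
      simp only [labels_append, labels_cons, List.mem_append, List.mem_cons, hv, hba.symm,
        false_or]
      exact not_mem_labels_of_ncw (c := c) (d := d) hba hcs (by simpa using hw)
  · exact ⟨[], [c], a, w, by simp, by simp, by simp, ha⟩

namespace IsCategory

theorem not_mem_point (hC : IsCategory C)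
    (hS : ¬ Mem C [(true, false), (false, true)]) {u v : Word α} {c : Bool} {a : α}
    (hu : a ∉ labels u) (hv : a ∉ labels v) : ¬ Mem C (u ++ (c, a) :: v) := by
  classical
  intro h
  have h1 := hC.mem_rotate h
  have h2 := hC.mem_tensor_bar_of_disjoint (s := [(c, a)]) (t := v ++ u) (by simpa using h1)
    (by simp [hu, hv])
  have h3 : Mem C [(c, Sum.inl a), (!c, (Sum.inr a : α ⊕ α))] := h2
  cases c
  · have h4 := hC.mem_rotate (u := [(false, Sum.inl a)]) (v := [(true, (Sum.inr a : α ⊕ α))]) h3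
    refine hS ((mem_relabel (fun x : α ⊕ α => x.isLeft) (by simp)).2 h4)
  · exact hS ((mem_relabel (fun x : α ⊕ α => x.isRight) (by simp)).2 h3)

/-- Interval blocks of words in a category without singletons have at least two points. -/
theorem exists_cons_cons (hC : IsCategory C)
    (hS : ¬ Mem C [(true, false), (false, true)]) {u v : Word α} {cs : List Bool} {a : α}
    (hcs : cs ≠ []) (hu : a ∉ labels u) (hv : a ∉ labels v) (h : Mem C (u ++ blk cs a ++ v)) :
    ∃ c d ds, cs = c :: d :: ds := by
  rcases cs with _ | ⟨c, _ | ⟨d, ds⟩⟩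
  · exact absurd rfl hcs
  · exact absurd (by simpa using h) (hC.not_mem_point hS (c := c) hu hv)
  · exact ⟨c, d, ds, rfl⟩

theorem memBlk_four_of_eq (hC : IsCategory C) (hW : ∀ c, MemBlk C [!c, c, !c, c])
    {u v : Word α} {c : Bool} {a : α} (h : Mem C (u ++ (c, a) :: (c, a) :: v)) :
    MemBlk C [true, true, false, false] := by
  classical
  have h1 := hC.mem_rotate h
  have h2 := hC.mem_selfglue (s := [(c, a), (c, a)]) (t := v ++ u) (by simpa using h1)
  set z : α ⊕ α := if a ∈ labels (v ++ u) then Sum.inl a else Sum.inr a with hz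
  have h3 := hC.mem_merge (u := [(c, (Sum.inl a : α ⊕ α))]) (c := c) (d := !c) (a := Sum.inl a)
    (b := z) (v := [(!c, z)]) (by simpa using hW c) h2
  have h4 : MemBlk C [c, c, !c, !c] := by
    rw [← mem_blk_iff (a := (Sum.inl a : α ⊕ α))]
    simpa using h3
  cases c
  · exact hC.memBlk_rotate (cs := [false, false]) (ds := [true, true]) h4
  · exact h4

theorem mem_of_mem_of_not_four (hC : IsCategory C) (hNC : ∀ p ∈ C, Noncrossing p)
    (hS : ¬ Mem C [(true, false), (false, true)]) (hW : ∀ c, MemBlk C [!c, c, !c, c])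
    (hF : ¬ MemBlk C [true, true, false, false]) {C₂ : Set TCP} (hC₂ : IsCategory C₂)
    (hW₂ : ∀ c, MemBlk C₂ [!c, c, !c, c]) {w : Word α} (h : Mem C w) : Mem C₂ w := by
  induction hn : w.length using Nat.strong_induction_on generalizing w with
  | _ n ih =>
  subst hn
  by_cases hw : w = []
  · subst hw
    exact hC₂.mem_nil
  obtain ⟨u, cs, b, v, rfl, hcs, hu, hv⟩ := exists_interval_block (ncw_of_mem hNC h) hw
  obtain ⟨c, d, ds, rfl⟩ := hC.exists_cons_cons hS hcs hu hv h
  have hd : d = !c := by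
    by_contra hd
    have : d = c := by cases c <;> cases d <;> simp_all
    subst this
    exact hF (hC.memBlk_four_of_eq hW (u := u) (v := blk ds b ++ v) (by simpa using h))
  subst hd
  rcases ds with _ | ⟨e, ds⟩
  · have h1 := hC.mem_contract_self (u := u) (v := v) (by simpa using h)
    have h2 := ih _ (by simp) h1 rfl
    have h3 := hC₂.mem_insert_of_disjoint h2 (hC₂.mem_pair c b) (by simp [hu, hv])
    simpa using h3
  · have he : e = c := by
      by_contra he
      have : e = !c := by cases c <;> cases e <;> simp_all
      subst this
      exact hF (hC.memBlk_four_of_eq hW (u := u ++ [(c, b)]) (v := blk ds b ++ v)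
        (by simpa using h))
    subst he
    have h1 := hC.mem_contract_self (u := u ++ [(e, b)]) (v := blk ds b ++ v) (c := !e)
      (by simpa using h)
    have h2 := ih _ (by simp) h1 rfl
    have h3 := hC₂.mem_replace_point (u := u) (c := e) (a := b) (v := blk ds b ++ v)
      (by simpa using h2) (hW₂ e)
    simpa using h3

theorem color_eq_not_of_not_four (hC : IsCategory C) (hNC : ∀ p ∈ C, Noncrossing p)
    (hS : ¬ Mem C [(true, false), (false, true)]) (hW : ∀ c, MemBlk C [!c, c, !c, c])
    (hF : ¬ MemBlk C [true, true, false, false]) {X Y : Word α} {x y : Bool} {a : α}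
    (hX : a ∉ labels X) (h : Mem C ((x, a) :: X ++ (y, a) :: Y)) : y = !x := by
  induction hn : X.length using Nat.strong_induction_on generalizing X with
  | _ n ih =>
  subst hn
  by_cases hX0 : X = []
  · subst hX0
    by_contra hy
    have : y = x := by cases x <;> cases y <;> simp_all
    subst this
    exact hF (hC.memBlk_four_of_eq hW (u := []) (v := Y) (by simpa using h))
  have hncw := ncw_of_mem hNC h
  obtain ⟨u, cs, b, v, rfl, hcs, hu, hv⟩ :=
    exists_interval_block (w := X) (ncw_of_sublist hncw (by simp)) hX0
  have hba : a ≠ b := by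
    rintro rfl
    obtain ⟨c', cs, rfl⟩ := List.exists_cons_of_ne_nil hcs
    simp at hX
  have hY : b ∉ labels Y := not_mem_labels_of_ncw hba hcs hncw
  obtain ⟨c, d, ds, rfl⟩ := hC.exists_cons_cons hS (u := (x, a) :: u) (v := v ++ (y, a) :: Y) (a := b) hcs
    (by simp [hba.symm, hu]) (by simp [hba.symm, hv, hY]) (by simpa using h)
  have hd : d = !c := by
    by_contra hd
    have : d = c := by cases c <;> cases d <;> simp_all
    subst this
    exact hF (hC.memBlk_four_of_eq hW (u := (x, a) :: u) (v := blk ds b ++ v ++ (y, a) :: Y)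
      (by simpa using h))
  subst hd
  have h1 := hC.mem_contract_self (u := (x, a) :: u) (v := blk ds b ++ v ++ (y, a) :: Y) (c := c)
    (a := b) (by simpa using h)
  exact ih _ (by simp) (X := u ++ blk ds b ++ v) (by simp at hX ⊢; tauto) (by simpa using h1) rfl

end IsCategory
end Noncrossing

section Sums

/-- The number of white colors minus the number of black colors. -/
def csum (cs : List Bool) : ℤ := (cs.map fun c => if c then (1 : ℤ) else -1).sum

@[simp] theorem csum_nil : csum [] = 0 := rfl

@[simp] theorem csum_cons (c : Bool) (cs : List Bool) :
    csum (c :: cs) = (if c then 1 else -1) + csum cs := by simp [csum]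

@[simp] theorem csum_append (cs ds : List Bool) : csum (cs ++ ds) = csum cs + csum ds := by
  simp [csum]

@[simp] theorem csum_cbar (cs : List Bool) : csum (cbar cs) = -csum cs := by
  induction cs with
  | nil => rfl
  | cons c cs ih =>
    have : cbar (c :: cs) = cbar cs ++ [!c] := by simp [cbar]
    rw [this, csum_append, ih]
    cases c <;> simp

@[simp] theorem csum_replicate (n : ℕ) (c : Bool) :
    csum (List.replicate n c) = n * (if c then 1 else -1) := by simp [csum]

theorem exists_opposite_neighbors (cs : List Bool) :
    (∃ p c q, cs = p ++ c :: (!c) :: q) ∨ ∃ n c, cs = List.replicate n c := by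
  induction cs with
  | nil => exact Or.inr ⟨0, true, rfl⟩
  | cons d cs ih =>
    rcases ih with ⟨p, c, q, rfl⟩ | ⟨n, c, rfl⟩
    · exact Or.inl ⟨d :: p, c, q, rfl⟩
    · rcases n with _ | n
      · exact Or.inr ⟨1, d, rfl⟩
      · by_cases h : c = d
        · subst h
          exact Or.inr ⟨n + 2, c, rfl⟩
        · have : c = !d := by cases c <;> cases d <;> simp_all
          subst this
          exact Or.inl ⟨[], d, List.replicate n (!d), rfl⟩

end Sums

section FullMerging
variable {α : Type} {C : Set TCP}

namespace IsCategory

theorem memBlk_of_csum_eq_zero (hC : IsCategory C) (hB : ∀ c d, MemBlk C [!c, c, d, !d])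
    {cs : List Bool} (h : csum cs = 0) : MemBlk C cs := by
  induction hn : cs.length using Nat.strong_induction_on generalizing cs with
  | _ n ih =>
  subst hn
  rcases exists_opposite_neighbors cs with ⟨p, c, q, rfl⟩ | ⟨n, c, rfl⟩
  · have hs : csum (p ++ q) = 0 := by
      rw [csum_append] at h ⊢
      cases c <;> simp at h <;> omega
    have h1 := ih (p ++ q).length (by simp) hs rfl
    rcases List.eq_nil_or_concat' p with rfl | ⟨p, d, rfl⟩
    · rcases q with _ | ⟨d, q⟩
      · exact hC.mem_pair c ()
      · have h2 := hC.mem_replace_point (u := []) (c := d) (a := ()) (v := blk q ())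
          (ds := [c, !c, d]) (by simpa [MemBlk] using h1)
          (hC.memBlk_rotate (cs := [d]) (ds := [!d, c, !c]) (by simpa using hB (!d) c))
        simpa [MemBlk] using h2
    · have h2 := hC.mem_replace_point (u := blk p ()) (c := d) (a := ()) (v := blk q ())
        (by simpa [MemBlk] using h1) (hB d c)
      simpa [MemBlk] using h2
  · have : n = 0 := by
      cases c <;> simpa using h
    subst this
    exact hC.mem_nil

theorem mem_contract_blk [DecidableEq α] (hC : IsCategory C) {u v : Word α} {a b : α}
    {ds : List Bool} (hds : ds ≠ []) (h : Mem C (u ++ blk (cbar ds) a ++ blk ds b ++ v)) :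
    Mem C (relabel (fuse a b) (u ++ v)) := by
  obtain ⟨c, ds, rfl⟩ := List.exists_cons_of_ne_nil hds
  have h1 := hC.mem_contract_fuse (u := u ++ blk (cbar ds) a) (c := !c) (a := a) (b := b)
    (v := blk ds b ++ v) (by simpa [cbar] using h)
  have h2 := hC.mem_cancel (u := relabel (fuse a b) u) (v := relabel (fuse a b) v) (bar (blk ds a))
    (by rw [bar_bar, bar_blk]; simpa using h1)
  simpa using h2

theorem mem_replace (hC : IsCategory C) (hB : ∀ c d, MemBlk C [!c, c, d, !d])
    {u v : Word α} {a : α} {cs ds : List Bool} (hcs : cs ≠ []) (hs : csum cs = csum ds)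
    (h : Mem C (u ++ blk cs a ++ v)) : Mem C (u ++ blk ds a ++ v) := by
  rcases List.eq_nil_or_concat' cs with rfl | ⟨cs, c, rfl⟩
  · exact absurd rfl hcs
  have h1 := hC.mem_replace_point (u := u ++ blk cs a) (c := c) (a := a) (v := v)
    (ds := cbar cs ++ ds) (by simpa using h) (hC.memBlk_of_csum_eq_zero hB (by
      rw [csum_append] at hs
      cases c <;> simp at hs ⊢ <;> omega))
  have h2 := hC.mem_cancel (u := u) (v := blk ds a ++ v) (blk cs a) (by
    simpa [bar_blk] using h1)
  simpa using h2

theorem mem_mergeAll (hC : IsCategory C) (hB : ∀ c d, MemBlk C [!c, c, d, !d])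
    {s t : Word α} {cs : List Bool} {a : α} (hcs : cs ≠ []) (ha : a ∉ labels t)
    (hd : ∀ b ∈ labels s, b ∉ labels t) (h : Mem C (blk cs a ++ s ++ t)) :
    Mem C (blk (cs ++ colors s) a ++ t) := by
  classical
  induction hn : s.length generalizing s cs with
  | zero =>
    obtain rfl := List.length_eq_zero_iff.1 hn
    simpa using h
  | succ n ih =>
    rcases s with _ | ⟨⟨d, b⟩, s⟩
    · simp at hn
    rcases List.eq_nil_or_concat' cs with rfl | ⟨cs, c, rfl⟩
    · exact absurd rfl hcs
    have h1 := hC.mem_merge (u := blk cs a) (c := c) (d := d) (a := a) (b := b) (v := s ++ t)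
      (hB c d) (by simpa using h)
    have ht : relabel (fuse a b) t = t := relabel_eq_self fun x hx => fuse_of_ne _ (by
      rintro rfl
      exact hd x (by simp) hx)
    have h2 := ih (s := relabel (fuse a b) s) (cs := cs ++ [c] ++ [d]) (by simp) ?_
      (by simpa [ht] using h1) (by simpa using hn)
    · simpa using h2
    · intro x hx
      simp only [labels_relabel, List.mem_map] at hx
      obtain ⟨y, hy, rfl⟩ := hx
      by_cases hyb : y = b
      · simpa [hyb] using ha
      · rw [fuse_of_ne _ hyb]
        exact hd y (by simp [hy])

theorem mem_mergeAll_left (hC : IsCategory C) (hB : ∀ c d, MemBlk C [!c, c, d, !d])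
    {s t : Word α} (hs : s ≠ []) (hd : ∀ b ∈ labels s, b ∉ labels t) (h : Mem C (s ++ t)) :
    ∃ a ∈ labels s, Mem C (blk (colors s) a ++ t) := by
  obtain ⟨⟨c, a⟩, s, rfl⟩ := List.exists_cons_of_ne_nil hs
  refine ⟨a, by simp, ?_⟩
  have := hC.mem_mergeAll hB (cs := [c]) (a := a) (s := s) (t := t) (by simp)
    (hd a (by simp)) (fun b hb => hd b (by simp [hb])) (by simpa using h)
  simpa using this

theorem mem_two_blocks (hC : IsCategory C) (hB : ∀ c d, MemBlk C [!c, c, d, !d])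
    {s t : Word α} (hs : s ≠ []) (ht : t ≠ []) (hd : ∀ b ∈ labels s, b ∉ labels t)
    (h : Mem C (s ++ t)) : Mem C (blk (colors s) false ++ blk (colors t) true) := by
  classical
  obtain ⟨a, ha, h1⟩ := hC.mem_mergeAll_left hB hs hd h
  obtain ⟨b, hb, h2⟩ := hC.mem_mergeAll_left hB ht (fun b hb hb' => by
    rw [eq_of_mem_labels_blk hb'] at hb
    exact hd a ha hb) (hC.mem_rotate h1)
  have hab : a ≠ b := by
    rintro rfl
    exact hd a ha hb
  rw [← mem_relabel (C := C) (fun x => decide (x = b))] at h2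
  · simpa [hab] using hC.mem_rotate (by simpa [hab] using h2)
  · intro x hx y hy
    have key : ∀ x ∈ blk (colors t) b ++ blk (colors s) a, x.2 = b ∨ x.2 = a := by
      intro x hx
      rcases List.mem_append.1 hx with hx | hx
      · exact Or.inl (eq_of_mem_labels_blk (mem_labels hx))
      · exact Or.inr (eq_of_mem_labels_blk (mem_labels hx))
    rcases key x hx with h | h <;> rcases key y hy with h' | h' <;> simp [h, h', hab]

/-- The color sums of the first block of partitions consisting of two neighboring blocks with
opposite color sums. -/
def sumsTwo (hC : IsCategory C) (hB : ∀ c d, MemBlk C [!c, c, d, !d]) : AddSubgroup ℤ where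
  carrier := {n | ∃ cs ds, cs ≠ [] ∧ ds ≠ [] ∧ csum cs = n ∧ csum ds = -n ∧
    Mem C (blk cs false ++ blk ds true)}
  zero_mem' := by
    refine ⟨[true, false], [true, false], by simp, by simp, by simp, by simp, ?_⟩
    have := hC.mem_insert_of_disjoint (u := blk [true, false] false) (v := [])
      (by simpa using hC.mem_pair true false) (hC.mem_pair true true) (by simp)
    simpa using this
  neg_mem' := by
    rintro n ⟨cs, ds, hcs, hds, h1, h2, h⟩
    refine ⟨ds, cs, hds, hcs, h2, by simpa using h1, ?_⟩
    have := hC.mem_rotate h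
    rw [← mem_relabel_injective (f := not) (by decide)] at this
    simpa using this
  add_mem' := by
    rintro n m ⟨cs, ds, hcs, hds, h1, h2, h⟩ ⟨cs', ds', hcs', hds', h1', h2', h'⟩
    refine ⟨cs ++ cs', ds' ++ ds, by simp [hcs], by simp [hds], by simp [h1, h1'], by
      simp [h2, h2'], ?_⟩
    have h3 := hC.mem_insert h h'
    have h4 := hC.mem_two_blocks hB (s := blk cs (Sum.inl false) ++ blk cs' (Sum.inr false))
      (t := blk ds' (Sum.inr true) ++ blk ds (Sum.inl true)) (by simpa [blk] using fun h => absurd h hcs)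
      (by simpa [blk] using fun h => absurd h hds') ?_ (by simpa using h3)
    · simpa using h4
    · intro b hb hb'
      rw [labels_append, List.mem_append] at hb hb'
      rcases hb with hb | hb <;> rcases hb' with hb' | hb' <;>
        have := (eq_of_mem_labels_blk hb).symm.trans (eq_of_mem_labels_blk hb') <;> simp at this

/-- The color sums of one-block partitions. -/
def sumsOne (hC : IsCategory C) (hB : ∀ c d, MemBlk C [!c, c, d, !d]) : AddSubgroup ℤ where
  carrier := {n | ∃ cs, cs ≠ [] ∧ csum cs = n ∧ MemBlk C cs}
  zero_mem' := ⟨[true, false], by simp, by simp, hC.mem_pair true ()⟩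
  neg_mem' := by
    rintro n ⟨cs, hcs, h1, h⟩
    exact ⟨cbar cs, by simpa [cbar] using hcs, by simp [h1], hC.memBlk_cbar h⟩
  add_mem' := by
    rintro n m ⟨cs, hcs, h1, h⟩ ⟨cs', hcs', h1', h'⟩
    refine ⟨cs ++ cs', by simp [hcs], by simp [h1, h1'], ?_⟩
    have h3 := hC.mem_insert (v := []) (by rw [List.append_nil]; exact h) h'
    obtain ⟨a, -, h4⟩ := hC.mem_mergeAll_left hB
      (s := blk cs (Sum.inl ()) ++ blk cs' (Sum.inr ())) (t := [])
      (by simpa [blk] using fun h => absurd h hcs) (by simp) (by simpa [MemBlk] using h3)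
    rw [List.append_nil, mem_blk_iff] at h4
    simpa using h4

theorem csum_mem_sumsTwo (hC : IsCategory C) (hB : ∀ c d, MemBlk C [!c, c, d, !d])
    {s t : Word α} (hs : s ≠ []) (hd : ∀ b ∈ labels s, b ∉ labels t) (h : Mem C (s ++ t)) :
    csum (colors s) ∈ hC.sumsTwo hB := by
  have hc : colors s ≠ [] := by simpa [colors] using hs
  refine ⟨colors s, cbar (colors s), hc, by simpa [cbar] using hc, rfl, by simp, ?_⟩
  have := hC.mem_two_blocks hB (by simpa [relabel] using hs) (by simpa [relabel, bar] using hs) ?_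
    (hC.mem_tensor_bar_of_disjoint h hd)
  · simpa using this
  · simp

theorem csum_mem_sumsOne (hC : IsCategory C) (hB : ∀ c d, MemBlk C [!c, c, d, !d])
    {w : Word α} (hw : w ≠ []) (h : Mem C w) : csum (colors w) ∈ hC.sumsOne hB := by
  obtain ⟨a, -, h1⟩ := hC.mem_mergeAll_left hB (t := []) hw (by simp) (by simpa using h)
  rw [List.append_nil, mem_blk_iff] at h1
  exact ⟨_, by simpa [colors] using hw, rfl, h1⟩

theorem sumsOne_le_sumsTwo (hC : IsCategory C) (hB : ∀ c d, MemBlk C [!c, c, d, !d]) :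
    hC.sumsOne hB ≤ hC.sumsTwo hB := by
  rintro n ⟨cs, hcs, rfl, h⟩
  simpa using hC.csum_mem_sumsTwo hB (s := blk cs ()) (t := []) (by simpa [blk] using hcs) (by simp)
    (by rw [List.append_nil]; exact h)

theorem memBlk_of_csum_mem (hC : IsCategory C) (hB : ∀ c d, MemBlk C [!c, c, d, !d])
    {cs : List Bool} (h : csum cs ∈ hC.sumsOne hB) : MemBlk C cs := by
  obtain ⟨ds, hds, hs, h⟩ := h
  simpa [MemBlk] using hC.mem_replace hB (u := []) (v := []) (a := ()) hds hs
    (by simpa [MemBlk] using h)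

theorem mem_blk_blk_of_csum_mem (hC : IsCategory C) (hB : ∀ c d, MemBlk C [!c, c, d, !d])
    {cs ds : List Bool} (h : csum cs ∈ hC.sumsTwo hB) (hs : csum ds = -csum cs) :
    Mem C (blk cs false ++ blk ds true) := by
  obtain ⟨cs', ds', hcs', hds', hs', hs'', h⟩ := h
  have h1 := hC.mem_replace hB (u := []) (v := blk ds' true) (a := false) hcs' hs'
    (by simpa using h)
  simpa using hC.mem_replace hB (u := blk cs false) (v := []) (a := true) hds'
    (hs''.trans hs.symm) (by simpa using h1)

theorem mem_of_sums_le (hC : IsCategory C) (hNC : ∀ p ∈ C, Noncrossing p)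
    (hB : ∀ c d, MemBlk C [!c, c, d, !d]) {C₂ : Set TCP} (hC₂ : IsCategory C₂)
    (hB₂ : ∀ c d, MemBlk C₂ [!c, c, d, !d]) (hone : hC.sumsOne hB ≤ hC₂.sumsOne hB₂)
    (htwo : hC.sumsTwo hB ≤ hC₂.sumsTwo hB₂) {w : Word α} (h : Mem C w) : Mem C₂ w := by
  classical
  induction hn : (labels w).toFinset.card using Nat.strong_induction_on generalizing w with
  | _ n ih =>
  subst hn
  by_cases hw : w = []
  · subst hw
    exact hC₂.mem_nil
  obtain ⟨u, cs, b, v, rfl, hcs, hu, hv⟩ := exists_interval_block (ncw_of_mem hNC h) hw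
  have h1 := hC.mem_rotate (u := u) (v := blk cs b ++ v) (by simpa using h)
  suffices h2 : Mem C₂ (blk cs b ++ (v ++ u)) by
    have := hC₂.mem_rotate (u := blk cs b ++ v) (v := u) (by simpa using h2)
    simpa using this
  rcases ht : v ++ u with _ | ⟨⟨x, b'⟩, t⟩
  · rw [List.append_assoc, ht, List.append_nil, mem_blk_iff] at h1
    rw [List.append_nil, mem_blk_iff]
    exact hC₂.memBlk_of_csum_mem hB₂ (hone ⟨cs, hcs, rfl, h1⟩)
  have hb : b ∉ labels ((x, b') :: t) := by
    rw [← ht]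
    simp [hu, hv]
  have hbb : b ≠ b' := fun h => hb (by simp [h])
  have hbt : b ∉ labels t := fun h => hb (by simp [h])
  rw [List.append_assoc, ht] at h1
  have hblk : blk cs b ≠ [] := by simpa [blk] using hcs
  have hn : csum cs ∈ hC₂.sumsTwo hB₂ := htwo (by
    simpa using hC.csum_mem_sumsTwo hB hblk (fun y hy => eq_of_mem_labels_blk hy ▸ hb) h1)
  have h2 : Mem C (relabel (fuse b b') (blk cs b ++ (x, b') :: t)) := by
    rcases List.eq_nil_or_concat' cs with rfl | ⟨cs, c, rfl⟩
    · exact absurd rfl hcs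
    have := hC.mem_merge (u := blk cs b) (hB c x) (by simpa using h1)
    simpa using this
  have h3 : Mem C₂ (relabel (fuse b b') (blk cs b ++ (x, b') :: t)) := by
    refine ih _ ?_ h2 rfl
    have hL : ∀ y, y ∈ (labels (u ++ blk cs b ++ v)).toFinset ↔
        y ∈ labels (blk cs b ++ (x, b') :: t) := by
      intro y
      rw [← ht]
      simp only [labels_append, List.mem_toFinset, List.mem_append]
      tauto
    refine (Finset.card_le_card fun y hy => ?_).trans_lt
      (Finset.card_erase_lt_of_mem ((hL b').2 (by simp)))
    rw [List.mem_toFinset, labels_relabel, List.mem_map] at hy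
    obtain ⟨z, hz, rfl⟩ := hy
    rw [Finset.mem_erase, hL]
    by_cases hzb : z = b'
    · obtain ⟨c, cs, rfl⟩ := List.exists_cons_of_ne_nil hcs
      simp [hzb, hbb]
    · rw [fuse_of_ne _ hzb]
      exact ⟨hzb, hz⟩
  have h4 := hC₂.mem_blk_blk_of_csum_mem hB₂ (ds := x :: cbar (cs ++ [x])) hn
    (by cases x <;> simp)
  have h5 := hC₂.mem_insert (v := []) (by rw [List.append_nil]; exact h4) h3
  have h6 := hC₂.mem_contract_blk (u := blk cs (Sum.inl false) ++ [(x, Sum.inl true)])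
    (a := Sum.inl true) (b := (Sum.inr b : Bool ⊕ α)) (ds := cs ++ [x])
    (v := relabel Sum.inr (relabel (fuse b b') t)) (by simp) (by simpa using h5)
  rw [← mem_relabel_injective (C := C₂)
    (f := fun y => if y = b then Sum.inl false else if y = b' then Sum.inl true else Sum.inr y)]
  · convert h6 using 1
    have key : relabel (fun y => if y = b then Sum.inl false else if y = b' then Sum.inl true
        else (Sum.inr y : Bool ⊕ α)) t =
        relabel (fuse (Sum.inl true) (Sum.inr b) ∘ Sum.inr ∘ fuse b b') t := by
      refine relabel_congr fun y hy => ?_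
      have hyb : y.2 ≠ b := fun h => hbt (h ▸ mem_labels hy)
      by_cases hy' : y.2 = b' <;> simp [hy', hyb, fuse, hbb.symm]
    simp [key, hbb.symm, fuse]
  · intro y z hyz
    by_cases h1 : y = b <;> by_cases h2 : z = b <;> by_cases h3 : y = b' <;>
      by_cases h4 : z = b' <;> simp_all

end IsCategory
end FullMerging

section Translation
variable {α : Type} {C : Set TCP}

theorem mkLower_eq (n : ℕ) (color : Fin n → Color) (lbl : Fin n → ℕ) :
    mkLower n color lbl = ofWords [] (List.ofFn fun i => (color i, lbl i)) := by
  refine eq_ofWords (k := 0) (l := n) rfl (by simp) (Sum.elim Fin.elim0 lbl) (fun i => i.elim0)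
    (fun j => by simp) fun x y => Iff.rfl

theorem fourBlock_mem_iff {a b c d : Bool} : fourBlock a b c d ∈ C ↔ MemBlk C [a, b, c, d] := by
  rw [fourBlock, mkLower_eq, ← mem_blk_iff (a := 0)]
  simp [Mem, blk, List.ofFn_succ]

theorem bPart_eq (s : ℕ) : bPart s = ofWords [] (blk (List.replicate s true) 0) := by
  rw [bPart, mkLower_eq]
  simp [blk, white]

theorem bPart_mem_iff {s : ℕ} : bPart s ∈ C ↔ MemBlk C (List.replicate s true) := by
  rw [bPart_eq, ← mem_blk_iff (a := 0)]
  rfl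

theorem vcref_ofWords (w : Word α) : vcref (ofWords [] w) = ofWords [] (bar w) := by
  refine eq_ofWords (k := 0) (l := w.length) rfl (by simp)
    (fun x => ptLabel [] w (Sum.map Fin.rev Fin.rev x)) (fun i => i.elim0) (fun j => ?_)
    fun x y => Iff.rfl
  have hj : w.length - (j.1 + 1) = w.length - 1 - j.1 := by omega
  simp [ptLabel, bar, vref, ofWords, hj, Fin.rev]

theorem tensor_blk_mem_iff {cs ds : List Bool} {a b : ℕ} :
    tensor (ofWords [] (blk cs a)) (ofWords [] (blk ds b)) ∈ C ↔
      Mem C (blk cs false ++ blk ds true) := by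
  rw [tensor_ofWords]
  have := IsCategory.mem_relabel (C := C) (fun x : ℕ ⊕ ℕ => x.isRight)
    (w := relabel Sum.inl (blk cs a) ++ relabel Sum.inr (blk ds b)) ?_
  · simpa [Mem] using this.symm
  · have key : ∀ x ∈ (relabel Sum.inl (blk cs a) ++ relabel Sum.inr (blk ds b) : Word (ℕ ⊕ ℕ)),
        x.2 = Sum.inl a ∨ x.2 = Sum.inr b := by
      intro x hx
      simp only [relabel_blk] at hx
      rcases List.mem_append.1 hx with hx | hx
      · exact Or.inl (eq_of_mem_labels_blk (mem_labels hx))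
      · exact Or.inr (eq_of_mem_labels_blk (mem_labels hx))
    intro x hx y hy
    rcases key x hx with h | h <;> rcases key y hy with h' | h' <;> simp [h, h']

theorem singPair_mem_iff : singPair ∈ C ↔ Mem C [(true, false), (false, true)] := by
  have h : ∀ c, singl c = ofWords [] (blk [c] 0) := fun c => by simp [singl, mkLower_eq, blk]
  rw [singPair, h, h, tensor_blk_mem_iff]
  rfl

theorem wwbb_mem_iff : wwbb ∈ C ↔ Mem C (blk [true, true] false ++ blk [false, false] true) := by
  have h : ∀ c, pairLower c c = ofWords [] (blk [c, c] 0) := fun c => by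
    simp [pairLower, mkLower_eq, blk]
  rw [wwbb, h, h, tensor_blk_mem_iff]
  rfl

theorem bPart_tensor_mem_iff {d : ℕ} : tensor (bPart d) (vcref (bPart d)) ∈ C ↔
    Mem C (blk (List.replicate d true) false ++ blk (List.replicate d false) true) := by
  have : cbar (List.replicate d true) = List.replicate d false := by simp [cbar]
  rw [bPart_eq, vcref_ofWords, bar_blk, tensor_blk_mem_iff, this]

theorem card_sub_card {n : ℕ} (f : Fin n → Bool) :
    (Nat.card {j // f j = true} : ℤ) - Nat.card {j // f j = false} = csum (List.ofFn f) := by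
  rw [csum, List.map_ofFn, List.sum_ofFn, Nat.card_eq_fintype_card, Nat.card_eq_fintype_card,
    Fintype.card_subtype, Fintype.card_subtype, Finset.card_filter, Finset.card_filter]
  push_cast
  rw [← Finset.sum_sub_distrib]
  refine Finset.sum_congr rfl fun i _ => ?_
  cases h : f i <;> simp [h]

theorem cval_ofWords (u v : Word α) : cval (ofWords u v) = csum (colors (bar u ++ v)) := by
  have h : ∀ w : Word α, List.ofFn (fun i : Fin w.length => w[i].1) = colors w := by
    intro w
    refine List.ext_getElem (by simp [colors]) ?_
    simp [colors]
  have hu := card_sub_card (fun i : Fin u.length => u[i].1)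
  have hv := card_sub_card (fun i : Fin v.length => v[i].1)
  rw [h] at hu hv
  rw [colors_append, csum_append, colors_bar, csum_cbar, ← hu, ← hv, cval]
  simp only [ofWords, white, black]
  push_cast
  ring

theorem kset_of_mem (hNC : ∀ p ∈ C, Noncrossing p) {s : Word α} {cs : List Bool} {x y : Bool}
    (hs : s ≠ []) (h : Mem C (relabel Sum.inl s ++ blk (x :: cs ++ [y]) (Sum.inr ()) : Word (α ⊕ Unit))) :
    csum (colors s) ∈ Kset C x y := by
  have h1 : tensor (ofWords [] s) (ofWords [] (blk (x :: cs ++ [y]) ())) ∈ C := by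
    rw [tensor_ofWords]
    simpa [Mem] using h
  refine ⟨ofWords [] s, ofWords [] (blk (x :: cs ++ [y]) ()), ⟨h1, hNC _ h1, rfl, rfl,
    List.length_pos_iff.2 hs, ?_, rfl, ?_, Subsingleton.elim _ _⟩, by simp [cval_ofWords]⟩
  · simp [ofWords, blk]
  · simp [ofWords, blk]

theorem exists_words_of_kset {n : ℤ} {x y : Bool} (h : n ∈ Kset C x y) :
    ∃ (α β : Type) (s : Word α) (t : Word β) (a : β), s ≠ [] ∧ csum (colors s) = n ∧
      Mem C (relabel Sum.inl s ++ relabel Sum.inr ((x, a) :: t ++ [(y, a)]) : Word (α ⊕ β)) := by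
  obtain ⟨p₁, p₂, ⟨hmem, -, hk₁, hk₂, hl₁, hl₂, hx, hy, hr⟩, rfl⟩ := h
  obtain ⟨α, u, s, rfl⟩ := exists_ofWords p₁
  obtain ⟨β, u', t, rfl⟩ := exists_ofWords p₂
  obtain rfl : u = [] := List.length_eq_zero_iff.1 hk₁
  obtain rfl : u' = [] := List.length_eq_zero_iff.1 hk₂
  have hlen : 2 ≤ t.length := hl₂
  rcases t with _ | ⟨⟨x', a⟩, t⟩
  · simp at hlen
  rcases List.eq_nil_or_concat' t with rfl | ⟨t, ⟨y', b⟩, rfl⟩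
  · simp at hlen
  have hab : a = ((((x', a) :: (t ++ [(y', b)])) : Word β)[((x', a) :: (t ++ [(y', b)])).length - 1]).2 := hr
  have hyy : ((((x', a) :: (t ++ [(y', b)])) : Word β)[((x', a) :: (t ++ [(y', b)])).length - 1]).1 = y := hy
  have hxx : x' = x := hx
  simp at hab hyy
  subst hab hxx hyy
  refine ⟨α, β, s, t, a, List.length_pos_iff.1 hl₁, by simp [cval_ofWords], ?_⟩
  rw [tensor_ofWords] at hmem
  exact hmem

end Translation

section Classification
variable {C : Set TCP}

theorem sInf_pos_mem (H : AddSubgroup ℤ) :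
    ((sInf {n : ℕ | 0 < n ∧ (n : ℤ) ∈ H} : ℕ) : ℤ) ∈ H := by
  rcases Set.eq_empty_or_nonempty {n : ℕ | 0 < n ∧ (n : ℤ) ∈ H} with h | h
  · simp [h]
  · exact (Nat.sInf_mem h).2

theorem le_of_sInf_pos_mem {H H' : AddSubgroup ℤ}
    (h : ((sInf {n : ℕ | 0 < n ∧ (n : ℤ) ∈ H} : ℕ) : ℤ) ∈ H') : H ≤ H' := by
  intro m hm
  have hd := sInf_pos_mem H
  set d := sInf {n : ℕ | 0 < n ∧ (n : ℤ) ∈ H} with hd'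
  have hpos : ∀ n : ℕ, (n : ℤ) ∈ H → 0 < n → 0 < d ∧ d ≤ n := fun n hn hn0 =>
    ⟨(Nat.sInf_mem (s := {n : ℕ | 0 < n ∧ (n : ℤ) ∈ H}) ⟨n, hn0, hn⟩).1, Nat.sInf_le ⟨hn0, hn⟩⟩
  have hdvd : (d : ℤ) ∣ m := by
    have hr : m % d ∈ H := by
      rw [Int.emod_def]
      exact H.sub_mem hm (by simpa [mul_comm] using H.zsmul_mem hd (m / d))
    have hnat : ((m % d).natAbs : ℤ) ∈ H := by
      rcases Int.natAbs_eq (m % d) with h | h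
      · rwa [← h]
      · rw [← neg_neg ((m % d).natAbs : ℤ), ← h]
        exact H.neg_mem hr
    rw [Int.dvd_iff_emod_eq_zero]
    by_contra hne
    obtain ⟨h1, h2⟩ := hpos _ hnat (Int.natAbs_pos.2 hne)
    have h3 := Int.emod_nonneg m (b := d) (by omega)
    have h4 := Int.emod_lt_of_pos m (b := d) (by omega)
    omega
  obtain ⟨z, rfl⟩ := hdvd
  simpa [mul_comm] using H'.zsmul_mem h z

theorem memBlk_of_fourWBWB (hC : IsCategory C) (h : fourWBWB ∈ C) (c : Bool) :
    MemBlk C [!c, c, !c, c] := by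
  have h1 : MemBlk C [true, false, true, false] := fourBlock_mem_iff.1 h
  cases c
  · exact h1
  · exact hC.memBlk_rotate (cs := [true]) (ds := [false, true, false]) h1

theorem memBlk_of_fours (hC : IsCategory C) (h : fourWBWB ∈ C)
    (hF : MemBlk C [true, true, false, false]) (c d : Bool) : MemBlk C [!c, c, d, !d] := by
  cases c <;> cases d
  · exact hC.memBlk_rotate (cs := [true]) (ds := [true, false, false]) hF
  · exact memBlk_of_fourWBWB hC h false
  · exact memBlk_of_fourWBWB hC h true
  · exact hC.memBlk_rotate (cs := [true, true, false]) (ds := [false]) hF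

theorem memBlk_of_wwbb (hC : IsCategory C) (h : fourWBWB ∈ C) (hG : wwbb ∈ C) :
    MemBlk C [true, true, false, false] := by
  have h1 := hC.mem_merge (u := [(true, false)]) (c := true) (a := false) (d := false) (b := true)
    (v := [(false, true)]) (memBlk_of_fourWBWB hC h true) (wwbb_mem_iff.1 hG)
  rw [← mem_blk_iff (a := false)]
  simpa using h1

theorem kdeg_eq (hC : IsCategory C) (hB : ∀ c d, MemBlk C [!c, c, d, !d]) :
    kdeg C = sInf {n : ℕ | 0 < n ∧ (n : ℤ) ∈ hC.sumsOne hB} := by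
  refine congrArg sInf (Set.ext fun n => and_congr_right fun hn => ⟨?_, ?_⟩)
  · rintro ⟨p, hp, h⟩
    obtain ⟨α, u, v, rfl⟩ := exists_ofWords p
    rw [hC.mem_ofWords_iff] at hp
    rw [cval_ofWords] at h
    rw [← h]
    refine hC.csum_mem_sumsOne hB ?_ hp
    intro h0
    rw [h0] at h
    simp at h
    omega
  · rintro ⟨cs, -, h1, h2⟩
    exact ⟨_, h2, by simpa [cval_ofWords] using h1⟩

theorem ddeg_eq (hC : IsCategory C) (hNC : ∀ p ∈ C, Noncrossing p)
    (hB : ∀ c d, MemBlk C [!c, c, d, !d]) :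
    ddeg C = sInf {n : ℕ | 0 < n ∧ (n : ℤ) ∈ hC.sumsTwo hB} := by
  refine congrArg sInf (Set.ext fun n => and_congr_right fun hn => ⟨fun h => ?_, fun h => ?_⟩)
  · obtain ⟨α, β, s, t, a, hs, h1, h2⟩ := exists_words_of_kset h
    rw [← h1]
    simpa using hC.csum_mem_sumsTwo hB (by simpa [relabel] using hs) (by simp) h2
  · have h1 := hC.mem_blk_blk_of_csum_mem hB (cs := List.replicate n true)
      (ds := true :: List.replicate n false ++ [false]) (by simpa using h) (by simp)
    rw [← IsCategory.mem_relabel_injective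
      (f := fun b : Bool => if b then Sum.inr () else (Sum.inl () : Unit ⊕ Unit))
      (by decide)] at h1
    have h2 := kset_of_mem (s := blk (List.replicate n true) ()) (cs := List.replicate n false)
      (x := true) (y := false) hNC (by simp [blk]; omega) (by simpa using h1)
    have h3 : (n : ℤ) ∈ Kset C true false := by simpa using h2
    exact h3

theorem memBlk_four_iff (hC : IsCategory C) (hNC : ∀ p ∈ C, Noncrossing p) (hH : CaseH C) :
    MemBlk C [true, true, false, false] ↔ Kset C black black ≠ ∅ := by
  constructor
  · intro hF
    have h1 := hC.mem_insert (u := [(true, ()), (false, ())]) (v := []) (hC.mem_pair true ())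
      (memBlk_of_fours hC hH.2 hF true true)
    have h2 := kset_of_mem (s := blk [true, false] ()) (cs := [true, true]) (x := false)
      (y := false) hNC (by simp) (by simpa using h1)
    exact Set.Nonempty.ne_empty ⟨_, h2⟩
  · intro hK
    by_contra hF
    obtain ⟨n, hn⟩ := Set.nonempty_iff_ne_empty.2 hK
    obtain ⟨α, β, s, t, a, hs, h1, h2⟩ := exists_words_of_kset hn
    have h3 := hC.mem_rotate (u := relabel Sum.inl s ++ relabel Sum.inr ((black, a) :: t))
      (v := [(black, Sum.inr a)]) (by simpa using h2)
    have h4 := hC.color_eq_not_of_not_four hNC (mt singPair_mem_iff.2 hH.1)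
      (memBlk_of_fourWBWB hC hH.2) hF (X := relabel Sum.inl s) (Y := relabel Sum.inr t)
      (x := black) (y := black) (a := Sum.inr a) (by simp) (by simpa using h3)
    simp [black] at h4

theorem one_notMem_sumsTwo (hC : IsCategory C) (hB : ∀ c d, MemBlk C [!c, c, d, !d])
    (hS : singPair ∉ C) : 1 ∉ hC.sumsTwo hB := fun h =>
  hS (singPair_mem_iff.2 (hC.mem_blk_blk_of_csum_mem hB (cs := [true]) (ds := [false])
    (by simpa using h) (by simp)))

theorem two_mem_sumsTwo_iff (hC : IsCategory C) (hB : ∀ c d, MemBlk C [!c, c, d, !d]) :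
    2 ∈ hC.sumsTwo hB ↔ wwbb ∈ C := by
  rw [wwbb_mem_iff]
  constructor
  · intro h
    exact hC.mem_blk_blk_of_csum_mem hB (by simpa using h) (by simp)
  · intro h
    exact ⟨[true, true], [false, false], by simp, by simp, by simp, by simp, h⟩

theorem even_of_mem_sumsTwo (hC : IsCategory C) (hB : ∀ c d, MemBlk C [!c, c, d, !d])
    (hS : singPair ∉ C) (hG : wwbb ∈ C) {n : ℤ} (hn : n ∈ hC.sumsTwo hB) : Even n := by
  by_contra hodd
  obtain ⟨m, rfl⟩ := Int.not_even_iff_odd.1 hodd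
  refine one_notMem_sumsTwo hC hB hS ?_
  have h2 := (hC.sumsTwo hB).zsmul_mem ((two_mem_sumsTwo_iff hC hB).2 hG) m
  have h3 := (hC.sumsTwo hB).sub_mem hn h2
  simpa [mul_comm] using h3

theorem bPart_mem_iff_sumsOne (hC : IsCategory C) (hB : ∀ c d, MemBlk C [!c, c, d, !d]) {s : ℕ} :
    bPart s ∈ C ↔ (s : ℤ) ∈ hC.sumsOne hB := by
  rw [bPart_mem_iff]
  constructor
  · intro h
    rcases Nat.eq_zero_or_pos s with rfl | hs
    · simp
    · exact ⟨_, by simp; omega, by simp, h⟩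
  · intro h
    exact hC.memBlk_of_csum_mem hB (by simpa using h)

theorem bPart_tensor_mem_iff_sumsTwo (hC : IsCategory C) (hB : ∀ c d, MemBlk C [!c, c, d, !d])
    {d : ℕ} : tensor (bPart d) (vcref (bPart d)) ∈ C ↔ (d : ℤ) ∈ hC.sumsTwo hB := by
  rw [bPart_tensor_mem_iff]
  constructor
  · intro h
    rcases Nat.eq_zero_or_pos d with rfl | hd
    · simp
    · exact ⟨_, _, by simp; omega, by simp; omega, by simp, by simp, h⟩
  · intro h
    exact hC.mem_blk_blk_of_csum_mem hB (by simpa using h) (by simp)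

theorem eq_generated {S : Set TCP} (hC : IsCategory C) (hS : S ⊆ C)
    (h : ∀ C₂, IsCategory C₂ → S ⊆ C₂ → ∀ {α : Type} {w : Word α}, Mem C w → Mem C₂ w) :
    C = generated S := by
  refine Set.Subset.antisymm (fun p hp C₂ hC₂ hS₂ => ?_) fun p hp => hp C hC hS
  obtain ⟨α, u, v, rfl⟩ := exists_ofWords p
  rw [hC.mem_ofWords_iff] at hp
  rw [hC₂.mem_ofWords_iff]
  exact h C₂ hC₂ hS₂ hp

end Classification

/-- Classification in case H. -/
theorem stmt_14 (C : Set TCP) (hC : IsCategory C) (hNC : ∀ p ∈ C, Noncrossing p)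
    (hH : CaseH C) :
    (GloballyColorized C → Even (kdeg C) ∧
        C = generated {bPart (kdeg C), fourWBWB, wwbb}) ∧
    (¬GloballyColorized C → Kset C black black = ∅ → C = generated {fourWBWB}) ∧
    (¬GloballyColorized C → Kset C black black ≠ ∅ →
        kdeg C ≠ 1 ∧ kdeg C ≠ 2 ∧ ddeg C ≠ 1 ∧ ddeg C ≠ 2 ∧
        C = generated {bPart (kdeg C),
          tensor (bPart (ddeg C)) (vcref (bPart (ddeg C))), fourWWBB, fourWBWB}) := by
  refine ⟨fun hG => ?_, fun _ hK => ?_, fun hG hK => ?_⟩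
  · have hB := memBlk_of_fours hC hH.2 (memBlk_of_wwbb hC hH.2 hG)
    have hk : (kdeg C : ℤ) ∈ hC.sumsOne hB := kdeg_eq hC hB ▸ sInf_pos_mem _
    refine ⟨?_, eq_generated hC ?_ fun C₂ hC₂ hS₂ => ?_⟩
    · exact_mod_cast even_of_mem_sumsTwo hC hB hH.1 hG (hC.sumsOne_le_sumsTwo hB hk)
    · rintro p (rfl | rfl | rfl)
      · exact (bPart_mem_iff_sumsOne hC hB).2 hk
      · exact hH.2
      · exact hG
    · have hW₂ : fourWBWB ∈ C₂ := hS₂ (by simp)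
      have hG₂ : wwbb ∈ C₂ := hS₂ (by simp)
      have hB₂ := memBlk_of_fours hC₂ hW₂ (memBlk_of_wwbb hC₂ hW₂ hG₂)
      intro α w
      refine hC.mem_of_sums_le hNC hB hC₂ hB₂ (le_of_sInf_pos_mem ?_) fun n hn => ?_
      · rw [← kdeg_eq hC hB]
        exact (bPart_mem_iff_sumsOne hC₂ hB₂).1 (hS₂ (by simp))
      · obtain ⟨m, rfl⟩ := even_iff_two_dvd.1 (even_of_mem_sumsTwo hC hB hH.1 hG hn)
        simpa [mul_comm] using
          (hC₂.sumsTwo hB₂).zsmul_mem ((two_mem_sumsTwo_iff hC₂ hB₂).2 hG₂) m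
  · have hF : ¬ MemBlk C [true, true, false, false] := fun h =>
      (memBlk_four_iff hC hNC hH).1 h hK
    refine eq_generated hC (by simpa using hH.2) fun C₂ hC₂ hS₂ => ?_
    exact hC.mem_of_mem_of_not_four hNC (mt singPair_mem_iff.2 hH.1)
      (memBlk_of_fourWBWB hC hH.2) hF hC₂ (memBlk_of_fourWBWB hC₂ (hS₂ rfl))
  · have hF := (memBlk_four_iff hC hNC hH).2 hK
    have hB := memBlk_of_fours hC hH.2 hF
    have hk : (kdeg C : ℤ) ∈ hC.sumsOne hB := kdeg_eq hC hB ▸ sInf_pos_mem _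
    have hd : (ddeg C : ℤ) ∈ hC.sumsTwo hB := ddeg_eq hC hNC hB ▸ sInf_pos_mem _
    have hk' := hC.sumsOne_le_sumsTwo hB hk
    have h1 := one_notMem_sumsTwo hC hB hH.1
    have h2 : 2 ∉ hC.sumsTwo hB := mt (two_mem_sumsTwo_iff hC hB).1 hG
    refine ⟨fun h => h1 ?_, fun h => h2 ?_, fun h => h1 ?_, fun h => h2 ?_,
      eq_generated hC ?_ fun C₂ hC₂ hS₂ => ?_⟩
    · simpa [h] using hk'
    · simpa [h] using hk'
    · simpa [h] using hd
    · simpa [h] using hd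
    · rintro p (rfl | rfl | rfl | rfl)
      · exact (bPart_mem_iff_sumsOne hC hB).2 hk
      · exact (bPart_tensor_mem_iff_sumsTwo hC hB).2 hd
      · exact fourBlock_mem_iff.2 hF
      · exact hH.2
    · have hB₂ := memBlk_of_fours hC₂ (hS₂ (by simp))
        (fourBlock_mem_iff.1 (hS₂ (by simp [fourWWBB, white, black])))
      intro α w
      refine hC.mem_of_sums_le hNC hB hC₂ hB₂ (le_of_sInf_pos_mem ?_) (le_of_sInf_pos_mem ?_)
      · rw [← kdeg_eq hC hB]
        exact (bPart_mem_iff_sumsOne hC₂ hB₂).1 (hS₂ (by simp))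
      · rw [← ddeg_eq hC hNC hB]
        exact (bPart_tensor_mem_iff_sumsTwo hC₂ hB₂).1 (hS₂ (by simp))

end CTCP
end
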